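/- Let M be a weight sequence such that m_k^{1/k}→∞, such that there exists C≥1 with Γ̄_m(Ct) ≤ Γ̲_m(t) for all t>0, and such that mg(M,M)<∞. Let U ⊆ ℝ^d be open and let j be a positive integer. If f : U → ℂ is a function such that f^j and f^{j+1} belong to the Roumieu Denjoy–Carleman class E^{{M}}(U), then f belongs to E^{{M}}(U). -/

import Mathlib

open Set Filter Topology Metric
open scoped ENNReal NNReal Topology

noncomputable section

namespace JorisPaper

/-- The sequence `m` with `m_k = M_k / k!`. -/
def lc (M : ℕ → ℝ) (k : ℕ) : ℝ := M k / (Nat.factorial k : ℝ)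

/-- A weight sequence: positive, log-convex, `M_0 = 1 ≤ M_1`, `M_k^{1/k} → ∞`. -/
structure IsWeightSeq (M : ℕ → ℝ) : Prop where
  pos : ∀ k, 0 < M k
  first : M 0 = 1
  one_le : 1 ≤ M 1
  logconvex : ∀ k, 1 ≤ k → M k ^ 2 ≤ M (k - 1) * M (k + 1)
  root : Filter.Tendsto (fun k : ℕ => M k ^ ((1 : ℝ) / (k : ℝ))) atTop atTop

/-- `m_k^{1/k} → ∞`. -/
def RootsTendsto (m : ℕ → ℝ) : Prop :=
  Filter.Tendsto (fun k : ℕ => m k ^ ((1 : ℝ) / (k : ℝ))) atTop atTop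

/-- `h_m(t) = inf_k m_k t^k` for `t > 0`, and `0` for `t ≤ 0`. -/
def hfn (m : ℕ → ℝ) (t : ℝ) : ℝ := if t ≤ 0 then 0 else ⨅ k : ℕ, m k * t ^ k

/-- `Γ̄_m(t) = min {k | h_m(t) = m_k t^k}`. -/
def GammaUpper (m : ℕ → ℝ) (t : ℝ) : ℕ := sInf {k : ℕ | hfn m t = m k * t ^ k}

/-- `Γ̲_m(t) = min {k | m_{k+1}/m_k ≥ 1/t}`. -/
def GammaLower (m : ℕ → ℝ) (t : ℝ) : ℕ := sInf {k : ℕ | 1 / t ≤ m (k + 1) / m k}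

/-- `mg(M,N) = sup_{j+k ≥ 1} (M_{j+k}/(N_j N_k))^{1/(j+k)}`, as an extended real. -/
def mg (M N : ℕ → ℝ) : ℝ≥0∞ :=
  ⨆ (j : ℕ) (k : ℕ) (_ : 1 ≤ j + k),
    ENNReal.ofReal ((M (j + k) / (N j * N k)) ^ (((j : ℝ) + (k : ℝ))⁻¹))

/-- A weight matrix: a totally ordered (pointwise) family of weight sequences. -/
structure IsWeightMatrix (W : Set (ℕ → ℝ)) : Prop where
  weight : ∀ M ∈ W, IsWeightSeq M
  ordered : ∀ M ∈ W, ∀ N ∈ W, (∀ k, M k ≤ N k) ∨ (∀ k, N k ≤ M k)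

/-- R-admissible weight matrix. -/
structure RAdmissible (W : Set (ℕ → ℝ)) : Prop where
  matrix : IsWeightMatrix W
  roots : ∀ M ∈ W, RootsTendsto (lc M)
  gamma : ∀ M ∈ W, ∃ N ∈ W, ∃ C : ℝ, 1 ≤ C ∧
    ∀ t : ℝ, 0 < t → GammaUpper (lc N) (C * t) ≤ GammaLower (lc M) t
  mgrowth : ∀ M ∈ W, ∃ N ∈ W, mg M N < ⊤

/-- B-admissible weight matrix. -/
structure BAdmissible (W : Set (ℕ → ℝ)) : Prop where
  matrix : IsWeightMatrix W
  roots : ∀ M ∈ W, RootsTendsto (lc M)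
  gamma : ∀ M ∈ W, ∃ N ∈ W, ∃ C : ℝ, 1 ≤ C ∧
    ∀ t : ℝ, 0 < t → GammaUpper (lc M) (C * t) ≤ GammaLower (lc N) t
  mgrowth : ∀ M ∈ W, ∃ N ∈ W, mg N M < ⊤

/-- `‖f‖^M_{K,ρ} < ∞` (derivatives taken within `U`). -/
def SeqBoundedOn {E F : Type*} [NormedAddCommGroup E] [NormedSpace ℝ E]
    [NormedAddCommGroup F] [NormedSpace ℝ F]
    (M : ℕ → ℝ) (ρ : ℝ) (f : E → F) (U K : Set E) : Prop :=
  ∃ C : ℝ, ∀ x ∈ K, ∀ k : ℕ, ‖iteratedFDerivWithin ℝ k f U x‖ ≤ C * ρ ^ k * M k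

/-- `f ∈ B^M_ρ(V)`: smooth on `V` with global bounds `‖f‖^M_{V,ρ} < ∞`. -/
def GlobalClass {E F : Type*} [NormedAddCommGroup E] [NormedSpace ℝ E]
    [NormedAddCommGroup F] [NormedSpace ℝ F]
    (M : ℕ → ℝ) (ρ : ℝ) (f : E → F) (V : Set E) : Prop :=
  ContDiffOn ℝ (⊤ : ℕ∞) f V ∧ SeqBoundedOn M ρ f V V

/-- The Roumieu class `E^{{W}}(U)`. -/
def Roumieu {E F : Type*} [NormedAddCommGroup E] [NormedSpace ℝ E]
    [NormedAddCommGroup F] [NormedSpace ℝ F]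
    (W : Set (ℕ → ℝ)) (U : Set E) (f : E → F) : Prop :=
  ContDiffOn ℝ (⊤ : ℕ∞) f U ∧
    ∀ K ⊆ U, IsCompact K → ∃ M ∈ W, ∃ ρ : ℝ, 0 < ρ ∧ SeqBoundedOn M ρ f U K

/-- The Beurling class `E^{(W)}(U)`. -/
def Beurling {E F : Type*} [NormedAddCommGroup E] [NormedSpace ℝ E]
    [NormedAddCommGroup F] [NormedSpace ℝ F]
    (W : Set (ℕ → ℝ)) (U : Set E) (f : E → F) : Prop :=
  ContDiffOn ℝ (⊤ : ℕ∞) f U ∧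
    ∀ K ⊆ U, IsCompact K → ∀ M ∈ W, ∀ ρ : ℝ, 0 < ρ → SeqBoundedOn M ρ f U K

/-- The open ellipse `Ω_ε` with vertices `±cosh ε` and co-vertices `±i sinh ε`. -/
def Omega (ε : ℝ) : Set ℂ :=
  {z : ℂ | (z.re / Real.cosh ε) ^ 2 + (z.im / Real.sinh ε) ^ 2 < 1}

/-- `V_U = ⋃_{x ∈ U} (x + 𝔹)`. -/
def VU {E : Type*} [NormedAddCommGroup E] [NormedSpace ℝ E] (U : Set E) : Set E :=
  ⋃ x ∈ U, Metric.closedBall x 1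

/-- A weight function in the sense of Braun–Meise–Taylor. -/
structure IsWeightFunction (ω : ℝ → ℝ) : Prop where
  cont : ContinuousOn ω (Ici 0)
  mono : MonotoneOn ω (Ici 0)
  nonneg : ∀ t, 0 ≤ t → 0 ≤ ω t
  bigO : (fun t => ω (2 * t)) =O[atTop] ω
  littleO : ω =o[atTop] (fun t => t)
  logLittleO : Real.log =o[atTop] ω
  convex : ConvexOn ℝ (Ici 0) (fun t => ω (Real.exp t))

/-- The Young conjugate `φ*_ω(s) = sup_{t ≥ 0} (s t - ω(e^t))`. -/
def youngConj (ω : ℝ → ℝ) (s : ℝ) : ℝ :=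
  sSup {y : ℝ | ∃ t : ℝ, 0 ≤ t ∧ y = s * t - ω (Real.exp t)}

/-- The Roumieu class `E^{{ω}}(U)` for a weight function `ω`. -/
def RoumieuW {E F : Type*} [NormedAddCommGroup E] [NormedSpace ℝ E]
    [NormedAddCommGroup F] [NormedSpace ℝ F]
    (ω : ℝ → ℝ) (U : Set E) (f : E → F) : Prop :=
  ContDiffOn ℝ (⊤ : ℕ∞) f U ∧
    ∀ K ⊆ U, IsCompact K → ∃ C : ℝ, 0 < C ∧ ∃ ρ : ℝ, 0 < ρ ∧
      ∀ x ∈ K, ∀ k : ℕ, ‖iteratedFDerivWithin ℝ k f U x‖ ≤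
        C * Real.exp ((1 / ρ) * youngConj ω (ρ * k))

/-- The Beurling class `E^{(ω)}(U)` for a weight function `ω`. -/
def BeurlingW {E F : Type*} [NormedAddCommGroup E] [NormedSpace ℝ E]
    [NormedAddCommGroup F] [NormedSpace ℝ F]
    (ω : ℝ → ℝ) (U : Set E) (f : E → F) : Prop :=
  ContDiffOn ℝ (⊤ : ℕ∞) f U ∧
    ∀ K ⊆ U, IsCompact K → ∀ ρ : ℝ, 0 < ρ → ∃ C : ℝ, 0 < C ∧
      ∀ x ∈ K, ∀ k : ℕ, ‖iteratedFDerivWithin ℝ k f U x‖ ≤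
        C * Real.exp ((1 / ρ) * youngConj ω (ρ * k))

lemma exists_le_of_mg_lt_top {M : ℕ → ℝ} (hM : IsWeightSeq M) (hmg : mg M M < ⊤) :
    ∃ ρ : ℝ, 1 ≤ ρ ∧ ∀ j k, M (j + k) ≤ ρ ^ (j + k) * (M j * M k) := by
  refine ⟨max 1 (mg M M).toReal, le_max_left _ _, fun j k => ?_⟩
  rcases Nat.eq_zero_or_pos (j + k) with h | h
  · obtain ⟨rfl, rfl⟩ : j = 0 ∧ k = 0 := by omega
    simp [hM.first]
  · have hMjk : 0 < M j * M k := mul_pos (hM.pos j) (hM.pos k)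
    have hq : 0 < M (j + k) / (M j * M k) := div_pos (hM.pos _) hMjk
    have h1 : ENNReal.ofReal ((M (j + k) / (M j * M k)) ^ (((j : ℝ) + (k : ℝ))⁻¹)) ≤ mg M M := by
      unfold mg
      exact le_iSup_of_le j (le_iSup_of_le k (le_iSup_of_le h le_rfl))
    have h2 : (M (j + k) / (M j * M k)) ^ (((j : ℝ) + (k : ℝ))⁻¹) ≤ max 1 (mg M M).toReal :=
      ((ENNReal.ofReal_le_iff_le_toReal hmg.ne).1 h1).trans (le_max_right _ _)
    have h3 := pow_le_pow_left₀ (Real.rpow_nonneg hq.le _) h2 (j + k)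
    rw [show ((j : ℝ) + (k : ℝ)) = ((j + k : ℕ) : ℝ) by push_cast; ring,
      Real.rpow_inv_natCast_pow hq.le (by omega), div_le_iff₀ hMjk] at h3
    exact h3

lemma lc_pos {M : ℕ → ℝ} (hM : IsWeightSeq M) (k : ℕ) : 0 < lc M k :=
  div_pos (hM.pos k) (by positivity)

lemma lc_zero {M : ℕ → ℝ} (hM : IsWeightSeq M) : lc M 0 = 1 := by simp [lc, hM.first]

lemma lc_add_le {M : ℕ → ℝ} (hM : IsWeightSeq M) {ρ : ℝ} (hρ : 1 ≤ ρ)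
    (h : ∀ j k, M (j + k) ≤ ρ ^ (j + k) * (M j * M k)) (j k : ℕ) :
    lc M (j + k) ≤ ρ ^ (j + k) * (lc M j * lc M k) := by
  unfold lc
  have hj := hM.pos j
  have hk := hM.pos k
  have hf : (j.factorial : ℝ) * k.factorial ≤ (j + k).factorial := by
    exact_mod_cast Nat.le_of_dvd (Nat.factorial_pos _) (Nat.factorial_mul_factorial_dvd_factorial_add j k)
  rw [div_mul_div_comm, ← mul_div_assoc]
  exact div_le_div₀ (by positivity) (h j k) (by positivity) hf

/-- If `m_k^{1/k} → ∞` then `m_k t^k → ∞`. -/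
lemma tendsto_mul_pow {m : ℕ → ℝ} (hpos : ∀ k, 0 < m k) (hroot : RootsTendsto m) {t : ℝ}
    (ht : 0 < t) : Tendsto (fun k => m k * t ^ k) atTop atTop := by
  have h1 : ∀ᶠ k : ℕ in atTop, 2 / t ≤ m k ^ ((1 : ℝ) / (k : ℝ)) :=
    hroot.eventually_ge_atTop _
  refine tendsto_atTop_mono' _ ?_ (tendsto_pow_atTop_atTop_of_one_lt (one_lt_two (α := ℝ)))
  filter_upwards [h1, eventually_gt_atTop 0] with k hk hk0
  have h2 := pow_le_pow_left₀ (by positivity) hk k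
  rw [one_div, Real.rpow_inv_natCast_pow (hpos k).le (by omega), div_pow,
    div_le_iff₀ (by positivity)] at h2
  exact h2

lemma hfn_of_pos {m : ℕ → ℝ} {t : ℝ} (ht : 0 < t) : hfn m t = ⨅ k : ℕ, m k * t ^ k := by
  simp [hfn, not_le.2 ht]

lemma bddBelow_mul_pow {m : ℕ → ℝ} (hpos : ∀ k, 0 < m k) {t : ℝ} (ht : 0 < t) :
    BddBelow (range fun k : ℕ => m k * t ^ k) :=
  ⟨0, by rintro _ ⟨k, rfl⟩; have := hpos k; positivity⟩

lemma hfn_le {m : ℕ → ℝ} (hpos : ∀ k, 0 < m k) {t : ℝ} (ht : 0 < t) (k : ℕ) :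
    hfn m t ≤ m k * t ^ k := by
  rw [hfn_of_pos ht]
  exact ciInf_le (bddBelow_mul_pow hpos ht) k

lemma exists_hfn_eq {m : ℕ → ℝ} (hpos : ∀ k, 0 < m k) (hroot : RootsTendsto m) {t : ℝ}
    (ht : 0 < t) : ∃ k, hfn m t = m k * t ^ k := by
  obtain ⟨k, hk⟩ :=
    (Nat.cofinite_eq_atTop ▸ tendsto_mul_pow hpos hroot ht).exists_forall_le
  refine ⟨k, le_antisymm (hfn_le hpos ht k) ?_⟩
  rw [hfn_of_pos ht]
  exact le_ciInf hk

lemma hfn_pos {m : ℕ → ℝ} (hpos : ∀ k, 0 < m k) (hroot : RootsTendsto m) {t : ℝ}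
    (ht : 0 < t) : 0 < hfn m t := by
  obtain ⟨k, hk⟩ := exists_hfn_eq hpos hroot ht
  have := hpos k
  rw [hk]; positivity

/-- The index `Γ̄_m(Ct)` realises `h_m(Ct)`, and up to it `m_k t^k` does not exceed `m_0`. -/
lemma exists_index {m : ℕ → ℝ} (hpos : ∀ k, 0 < m k) (hroot : RootsTendsto m) {C t : ℝ}
    (hC : 1 ≤ C) (ht : 0 < t) (hG : GammaUpper m (C * t) ≤ GammaLower m t) :
    ∃ N, hfn m (C * t) = m N * (C * t) ^ N ∧ ∀ k ≤ N, m k * t ^ k ≤ m 0 := by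
  refine ⟨GammaUpper m (C * t), Nat.sInf_mem (exists_hfn_eq hpos hroot (by positivity)), ?_⟩
  intro k
  induction k with
  | zero => simp
  | succ k ih =>
    intro hk
    refine le_trans ?_ (ih (by omega))
    have h1 : ¬ (1 / t ≤ m (k + 1) / m k) := by
      intro h
      have : GammaLower m t ≤ k := Nat.sInf_le h
      omega
    have hk0 := hpos k
    rw [not_le, div_lt_div_iff₀ hk0 ht] at h1
    have : 0 < t ^ k := by positivity
    rw [pow_succ]
    nlinarith

/-- Powers of `h_m` are absorbed by dilations. -/
lemma exists_hfn_le_pow {m : ℕ → ℝ} (hpos : ∀ k, 0 < m k) (hroot : RootsTendsto m)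
    (h0 : m 0 = 1) {ρ : ℝ} (hρ : 1 ≤ ρ)
    (h : ∀ j k, m (j + k) ≤ ρ ^ (j + k) * (m j * m k)) (q : ℕ) :
    ∃ B : ℝ, 1 ≤ B ∧ ∀ t, 0 < t → hfn m t ≤ hfn m (B * t) ^ q := by
  have hsq : ∀ t, 0 < t → hfn m t ≤ hfn m (ρ * t) ^ 2 := by
    intro t ht
    obtain ⟨k, hk⟩ := exists_hfn_eq hpos hroot (show 0 < ρ * t by positivity)
    rw [hk]
    calc hfn m t ≤ m (k + k) * t ^ (k + k) := hfn_le hpos ht _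
      _ ≤ (ρ ^ (k + k) * (m k * m k)) * t ^ (k + k) := by gcongr; exact h k k
      _ = (m k * (ρ * t) ^ k) ^ 2 := by rw [mul_pow]; ring
  have hpow : ∀ n : ℕ, ∀ t, 0 < t → hfn m t ≤ hfn m (ρ ^ n * t) ^ (2 ^ n) := by
    intro n
    induction n with
    | zero => intro t _; simp
    | succ n ih =>
      intro t ht
      refine (ih t ht).trans ?_
      have h1 := hsq (ρ ^ n * t) (by positivity)
      have h2 := pow_le_pow_left₀ (hfn_pos hpos hroot (by positivity)).le h1 (2 ^ n)
      rw [← pow_mul, ← mul_assoc, ← pow_succ', ← pow_succ'] at h2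
      exact h2
  refine ⟨ρ ^ q, one_le_pow₀ hρ, fun t ht => (hpow q t ht).trans ?_⟩
  have ht' : 0 < ρ ^ q * t := by positivity
  refine pow_le_pow_of_le_one (hfn_pos hpos hroot ht').le ?_ Nat.lt_two_pow_self.le
  simpa [h0] using hfn_le hpos ht' 0

lemma normSq_sin (z : ℂ) :
    Complex.normSq (Complex.sin z) = Real.sin z.re ^ 2 + Real.sinh z.im ^ 2 := by
  have h : Complex.sin z = ((Real.sin z.re * Real.cosh z.im : ℝ) : ℂ) +
      ((Real.cos z.re * Real.sinh z.im : ℝ) : ℂ) * Complex.I := by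
    rw [Complex.sin_eq]; push_cast; ring
  rw [h, Complex.normSq_add_mul_I, mul_pow, mul_pow, Real.cosh_sq, Real.cos_sq']
  ring

lemma norm_sin_le_cosh (z : ℂ) : ‖Complex.sin z‖ ≤ Real.cosh z.im := by
  refine abs_le_of_sq_le_sq' ?_ (Real.cosh_pos _).le |>.2
  rw [← Complex.normSq_eq_norm_sq, normSq_sin, Real.cosh_sq]
  nlinarith [Real.sin_sq_le_one z.re]

lemma abs_im_le_norm_sin (z : ℂ) : |z.im| ≤ ‖Complex.sin z‖ := by
  have h1 : |z.im| ≤ |Real.sinh z.im| := by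
    rw [Real.abs_sinh]
    exact Real.self_le_sinh_iff.2 (abs_nonneg _)
  refine h1.trans (abs_le_of_sq_le_sq ?_ (norm_nonneg _))
  rw [← Complex.normSq_eq_norm_sq, normSq_sin]
  nlinarith [sq_nonneg (Real.sin z.re)]

lemma cosh_one_lt_two : Real.cosh 1 < 2 := by
  rw [Real.cosh_eq]
  have h1 := Real.exp_one_lt_d9
  have h2 : Real.exp (-1) < 1 := by simp
  linarith

/-- Two-constants theorem on the disc with a real diameter. -/
lemma norm_sq_le_of_real_diameter {P : ℂ → ℂ} {A η r : ℝ} (hr : 0 < r)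
    (hP : DifferentiableOn ℂ P (ball 0 r)) (hA : ∀ z ∈ ball (0 : ℂ) r, ‖P z‖ ≤ A)
    (hη0 : 0 ≤ η) (hηA : η ≤ A) (hη : ∀ x : ℝ, |x| < r → ‖P x‖ ≤ η) :
    ∀ z ∈ ball (0 : ℂ) (r / 4), ‖P z‖ ^ 2 ≤ A * η := by
  intro z hz
  have hA0 : 0 ≤ A := hη0.trans hηA
  have hmaps : ∀ w ∈ Complex.HadamardThreeLines.verticalClosedStrip 0 1,
      (r / 2 : ℂ) * Complex.sin (Complex.I * w) ∈ ball (0 : ℂ) r := by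
    intro w hw
    have hw' : w.re ∈ Icc (0 : ℝ) 1 := hw
    have h1 : ‖Complex.sin (Complex.I * w)‖ < 2 := by
      refine (norm_sin_le_cosh _).trans_lt (lt_of_le_of_lt ?_ cosh_one_lt_two)
      rw [Real.cosh_le_cosh]
      simpa [abs_of_nonneg hw'.1] using hw'.2
    have h2 : ‖(r / 2 : ℂ)‖ = r / 2 := by
      rw [show (r / 2 : ℂ) = ((r / 2 : ℝ) : ℂ) by push_cast; rfl, Complex.norm_real,
        Real.norm_of_nonneg (by positivity)]
    rw [mem_ball_zero_iff, norm_mul, h2]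
    nlinarith
  obtain ⟨ζ, hζ, hζ0⟩ : ∃ ζ : ℂ, Complex.sin ζ = 2 / r * z ∧ 0 ≤ ζ.im := by
    obtain ⟨ζ, hζ⟩ := Complex.sin_surjective (2 / r * z)
    rcases le_total 0 ζ.im with h | h
    · exact ⟨ζ, hζ, h⟩
    · exact ⟨Real.pi - ζ, by rw [Complex.sin_pi_sub, hζ], by simpa using h⟩
  have hζ2 : ζ.im ≤ 1 / 2 := by
    have h1 := (le_abs_self _).trans (abs_im_le_norm_sin ζ)
    rw [mem_ball_zero_iff] at hz
    rw [hζ, norm_mul, norm_div, Complex.norm_real, Real.norm_of_nonneg hr.le] at h1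
    refine h1.trans ?_
    rw [div_mul_eq_mul_div, div_le_iff₀ hr]
    norm_num
    linarith
  set Q : ℂ → ℂ := fun w => P ((r / 2 : ℂ) * Complex.sin (Complex.I * w)) with hQ
  have hQd : DiffContOnCl ℂ Q (Complex.HadamardThreeLines.verticalStrip 0 1) := by
    apply DifferentiableOn.diffContOnCl
    have hcl : closure (Complex.HadamardThreeLines.verticalStrip 0 1) ⊆
        Complex.HadamardThreeLines.verticalClosedStrip 0 1 := by
      apply closure_minimal
      · exact preimage_mono Ioo_subset_Icc_self
      · exact isClosed_Icc.preimage Complex.continuous_re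
    intro w hw
    refine DifferentiableAt.differentiableWithinAt ?_
    refine DifferentiableAt.comp w ((hP _ (hmaps w (hcl hw))).differentiableAt
      (isOpen_ball.mem_nhds (hmaps w (hcl hw)))) ?_
    fun_prop
  have hmain := Complex.HadamardThreeLines.norm_le_interp_of_mem_verticalClosedStrip₀₁' Q
    (z := -Complex.I * ζ) (a := η) (b := A) ?_ hQd ?_ ?_ ?_
  · have hQz : Q (-Complex.I * ζ) = P z := by
      have hr' : (r : ℂ) ≠ 0 := by exact_mod_cast hr.ne'
      simp only [hQ]
      rw [← mul_assoc, mul_neg, Complex.I_mul_I, neg_neg, one_mul, hζ]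
      congr 1
      field_simp
    have hre : (-Complex.I * ζ).re = ζ.im := by simp
    rw [hQz, hre] at hmain
    rcases hη0.eq_or_lt with h0 | h0
    · rw [← h0, Real.zero_rpow (by linarith), zero_mul] at hmain
      rw [← h0, mul_zero]
      nlinarith [norm_nonneg (P z)]
    · have hApos : 0 < A := h0.trans_le hηA
      have : η ^ (1 - ζ.im) * A ^ ζ.im ≤ η ^ (1 / 2 : ℝ) * A ^ (1 / 2 : ℝ) := by
        have e1 : η ^ (1 - ζ.im) = η ^ (1 / 2 : ℝ) * η ^ (1 / 2 - ζ.im) := by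
          rw [← Real.rpow_add h0]; ring_nf
        have e2 : A ^ (1 / 2 : ℝ) = A ^ (1 / 2 - ζ.im) * A ^ ζ.im := by
          rw [← Real.rpow_add hApos]; ring_nf
        rw [e1, e2, mul_assoc]
        gcongr
      have h3 := pow_le_pow_left₀ (norm_nonneg _) (hmain.trans this) 2
      rw [mul_pow, ← Real.sqrt_eq_rpow, ← Real.sqrt_eq_rpow, Real.sq_sqrt hη0, Real.sq_sqrt hA0] at h3
      linarith
  · change (-Complex.I * ζ).re ∈ Icc (0 : ℝ) 1
    simp only [neg_mul, Complex.neg_re, Complex.mul_re, Complex.I_re, zero_mul, Complex.I_im,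
      one_mul, zero_sub, neg_neg, mem_Icc]
    exact ⟨hζ0, by linarith⟩
  · refine ⟨A, ?_⟩
    rintro _ ⟨w, hw, rfl⟩
    exact hA _ (hmaps w hw)
  · intro w hw
    have hw0 : w.re = 0 := hw
    have : (r / 2 : ℂ) * Complex.sin (Complex.I * w) =
        ((r / 2 * Real.sin (-w.im) : ℝ) : ℂ) := by
      have : Complex.I * w = ((-w.im : ℝ) : ℂ) := by
        apply Complex.ext <;> simp [hw0]
      rw [this]; push_cast; rfl
    simp only [hQ]
    rw [this]
    apply hη
    rw [abs_mul, abs_of_pos (by positivity : 0 < r / 2)]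
    nlinarith [Real.abs_sin_le_one (-w.im)]
  · intro w hw
    have hw1 : w.re = 1 := hw
    apply hA
    apply hmaps
    change w.re ∈ Icc (0 : ℝ) 1
    simp [hw1]

section Integrals

open MeasureTheory

/-- The Cauchy–Riemann operator `∂̄`. -/
def dbar (f : ℂ → ℂ) (z : ℂ) : ℂ :=
  (1 / 2 : ℂ) * (fderiv ℝ f z 1 + Complex.I * fderiv ℝ f z Complex.I)

lemma dbar_mul {f g : ℂ → ℂ} {z : ℂ} (hf : DifferentiableAt ℝ f z) (hg : DifferentiableAt ℝ g z) :
    dbar (fun w => f w * g w) z = dbar f z * g z + f z * dbar g z := by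
  simp only [dbar, fderiv_fun_mul hf hg]
  simp
  ring

lemma dbar_sub {f g : ℂ → ℂ} {z : ℂ} (hf : DifferentiableAt ℝ f z) (hg : DifferentiableAt ℝ g z) :
    dbar (fun w => f w - g w) z = dbar f z - dbar g z := by
  simp only [dbar, fderiv_fun_sub hf hg]
  simp
  ring

lemma dbar_of_differentiableAt {f : ℂ → ℂ} {z : ℂ} (hf : DifferentiableAt ℂ f z) :
    dbar f z = 0 := by
  have h := (differentiableAt_complex_iff_differentiableAt_real.1 hf).2
  rw [dbar, h, smul_eq_mul, ← mul_assoc, Complex.I_mul_I]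
  ring

lemma differentiableAt_of_dbar_eq_zero {f : ℂ → ℂ} {z : ℂ} (hf : DifferentiableAt ℝ f z)
    (h : dbar f z = 0) : DifferentiableAt ℂ f z := by
  refine differentiableAt_complex_iff_differentiableAt_real.2 ⟨hf, ?_⟩
  have h1 : fderiv ℝ f z 1 + Complex.I * fderiv ℝ f z Complex.I = 0 := by
    simpa [dbar] using h
  rw [smul_eq_mul]
  linear_combination -Complex.I * h1 + fderiv ℝ f z Complex.I * Complex.I_mul_I

lemma dbar_conj {f : ℂ → ℂ} {z : ℂ} (hf : DifferentiableAt ℂ f z) :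
    dbar (fun w => (starRingEnd ℂ) (f w)) z = (starRingEnd ℂ) (deriv f z) := by
  have h : HasFDerivAt (fun w => (starRingEnd ℂ) (f w))
      (Complex.conjCLE.toContinuousLinearMap.comp ((fderiv ℂ f z).restrictScalars ℝ)) z :=
    Complex.conjCLE.hasFDerivAt.comp z (hf.hasFDerivAt.restrictScalars ℝ)
  rw [dbar, h.fderiv]
  have h2 : fderiv ℂ f z Complex.I = Complex.I * deriv f z := by
    rw [fderiv_eq_smul_deriv, smul_eq_mul]
  simp only [ContinuousLinearMap.comp_apply, ContinuousLinearMap.coe_restrictScalars', h2]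
  simp [← mul_assoc]
  ring

lemma dbar_ofReal_comp {S : ℂ → ℝ} {φ : ℝ → ℝ} {φ' : ℝ} {z : ℂ} (hS : DifferentiableAt ℝ S z)
    (hφ : HasDerivAt φ φ' (S z)) :
    dbar (fun w => ((φ (S w) : ℝ) : ℂ)) z = φ' * dbar (fun w => (S w : ℂ)) z := by
  have h1 : HasFDerivAt (fun w => (S w : ℂ)) (Complex.ofRealCLM.comp (fderiv ℝ S z)) z :=
    Complex.ofRealCLM.hasFDerivAt.comp z hS.hasFDerivAt
  have h2 : HasFDerivAt (fun w => ((φ (S w) : ℝ) : ℂ))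
      (Complex.ofRealCLM.comp (φ' • fderiv ℝ S z)) z :=
    Complex.ofRealCLM.hasFDerivAt.comp z (hφ.comp_hasFDerivAt z hS.hasFDerivAt)
  rw [dbar, dbar, h1.fderiv, h2.fderiv]
  simp
  ring

lemma integral_dbar_eq_zero {f : ℂ → ℂ} (hf : ContDiff ℝ 1 f) (hc : HasCompactSupport f) :
    ∫ z, dbar f z = 0 := by
  have hd : Continuous (fderiv ℝ f) := hf.continuous_fderiv one_ne_zero
  have hi : ∀ v : ℂ, Integrable fun z => fderiv ℝ f z v := fun v =>
    (hd.clm_apply continuous_const).integrable_of_hasCompactSupport (hc.fderiv_apply ℝ v)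
  have h0 : ∀ v : ℂ, ∫ z, fderiv ℝ f z v = 0 := by
    intro v
    have := integral_mul_fderiv_eq_neg_fderiv_mul_of_integrable (μ := (volume : Measure ℂ))
      (f := fun _ : ℂ => (1 : ℂ)) (g := f) (v := v) (by simp) (by simpa using hi v)
      (by simpa using hf.continuous.integrable_of_hasCompactSupport hc)
      (fun x _ => differentiableAt_const _) (fun x _ => hf.differentiable one_ne_zero x)
    simpa using this
  simp only [dbar]
  rw [integral_const_mul, integral_add (hi 1) ((hi _).const_mul _), integral_const_mul, h0, h0]
  simp

/-- `‖z‖^(-2+s)` is integrable near the origin of the plane. -/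
lemma integrableOn_norm_rpow {s : ℝ} (hs : 0 < s) (R : ℝ) :
    IntegrableOn (fun z : ℂ => ‖z‖ ^ (-2 + s)) (ball 0 R) := by
  have h := (integrable_fun_norm_addHaar (volume : Measure ℂ)
    (f := indicator (Iio R) fun t : ℝ => t ^ (-2 + s))).2 ?_
  · rw [← integrable_indicator_iff measurableSet_ball]
    refine h.congr (Eventually.of_forall fun z => ?_)
    by_cases hz : ‖z‖ < R <;> simp [indicator, hz]
  · rw [← integrable_indicator_iff measurableSet_Ioi]
    have h1 : IntegrableOn (fun t : ℝ => t ^ (s - 1)) (Ioo 0 R) := by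
      rcases le_or_gt R 0 with hR | hR
      · simp [Ioo_eq_empty (not_lt.2 hR)]
      · exact (intervalIntegral.integrableOn_Ioo_rpow_iff hR).2 (by linarith)
    rw [← integrable_indicator_iff measurableSet_Ioo] at h1
    refine h1.congr (Eventually.of_forall fun t => ?_)
    simp only [indicator, Complex.finrank_real_complex, mem_Ioo, mem_Ioi, mem_Iio]
    by_cases h0 : 0 < t
    · by_cases hR : t < R
      · simp only [h0, hR, and_self, if_true]
        rw [show s - 1 = 1 + (-2 + s) by ring, Real.rpow_add h0]
        simp
      · simp [hR]
    · simp [h0]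

lemma locallyIntegrable_inv : LocallyIntegrable (fun z : ℂ => z⁻¹) := by
  intro z
  refine ⟨ball 0 (‖z‖ + 1), isOpen_ball.mem_nhds (by simp), ?_⟩
  refine (integrableOn_norm_rpow one_pos (‖z‖ + 1)).mono' ?_ (Eventually.of_forall fun w => ?_)
  · exact measurable_inv.aestronglyMeasurable
  · rw [norm_inv, show (-2 + 1 : ℝ) = -1 by norm_num, Real.rpow_neg_one]

/-- The Cauchy transform. -/
def cauchyTransform (ψ : ℂ → ℂ) (z : ℂ) : ℂ := (Real.pi : ℂ)⁻¹ * ∫ w, w⁻¹ * ψ (z - w)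

lemma circle_integral_tangential {ψ : ℂ → ℂ} (hψ : ContDiff ℝ 1 ψ) (z : ℂ) {r : ℝ} (hr : 0 < r) :
    ∫ θ in (-Real.pi)..Real.pi, fderiv ℝ ψ (z - r * Complex.exp (θ * Complex.I))
      (Complex.I * Complex.exp (θ * Complex.I)) = 0 := by
  have hd : ∀ θ : ℝ, HasDerivAt (fun θ : ℝ => ψ (z - r * Complex.exp (θ * Complex.I)))
      ((-r : ℝ) • fderiv ℝ ψ (z - r * Complex.exp (θ * Complex.I))
      (Complex.I * Complex.exp (θ * Complex.I))) θ := by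
    intro θ
    have h1 : HasDerivAt (fun θ : ℝ => z - r * Complex.exp (θ * Complex.I))
        ((-r : ℝ) • (Complex.I * Complex.exp (θ * Complex.I))) θ := by
      have h2 : HasDerivAt (fun θ : ℝ => (θ : ℂ) * Complex.I) Complex.I θ := by
        simpa using (Complex.ofRealCLM.hasDerivAt (x := θ)).mul_const Complex.I
      have h3 := (h2.cexp.const_mul (r : ℂ)).const_sub z
      refine h3.congr_deriv ?_
      rw [Complex.real_smul]; push_cast; ring
    have := (hψ.differentiable one_ne_zero _).hasFDerivAt.comp_hasDerivAt θ h1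
    rwa [map_smul] at this
  have hcont : Continuous fun θ : ℝ => fderiv ℝ ψ (z - r * Complex.exp (θ * Complex.I))
      (Complex.I * Complex.exp (θ * Complex.I)) :=
    ((hψ.continuous_fderiv one_ne_zero).comp (by fun_prop)).clm_apply (by fun_prop)
  have h := intervalIntegral.integral_eq_sub_of_hasDerivAt (a := -Real.pi) (b := Real.pi)
    (fun θ _ => hd θ) ((hcont.const_smul (-r : ℝ)).intervalIntegrable _ _)
  rw [intervalIntegral.integral_smul] at h
  have hend : ψ (z - r * Complex.exp ((Real.pi : ℝ) * Complex.I)) -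
      ψ (z - r * Complex.exp (((-Real.pi : ℝ) : ℂ) * Complex.I)) = 0 := by
    have : Complex.exp (((-Real.pi : ℝ) : ℂ) * Complex.I) = Complex.exp ((Real.pi : ℝ) * Complex.I) := by
      rw [Complex.ofReal_neg, neg_mul, Complex.exp_neg, Complex.exp_pi_mul_I]; norm_num
    rw [this, sub_self]
  rw [hend] at h
  simpa [hr.ne'] using h

lemma radial_integral {ψ : ℂ → ℂ} (hψ : ContDiff ℝ 1 ψ) (z e : ℂ) {R : ℝ}
    (hR : ψ (z - R * e) = 0) :
    ∫ r in (0 : ℝ)..R, fderiv ℝ ψ (z - r * e) e = ψ z := by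
  have hd : ∀ r : ℝ, HasDerivAt (fun r : ℝ => ψ (z - r * e))
      (-fderiv ℝ ψ (z - r * e) e) r := by
    intro r
    have h1 : HasDerivAt (fun r : ℝ => z - r * e) (-e) r := by
      simpa using ((Complex.ofRealCLM.hasDerivAt (x := r)).mul_const e).const_sub z
    have := (hψ.differentiable one_ne_zero _).hasFDerivAt.comp_hasDerivAt r h1
    rwa [map_neg] at this
  have hcont : Continuous fun r : ℝ => fderiv ℝ ψ (z - r * e) e :=
    ((hψ.continuous_fderiv one_ne_zero).comp (by fun_prop)).clm_apply (by fun_prop)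
  have h := intervalIntegral.integral_eq_sub_of_hasDerivAt (a := 0) (b := R)
    (fun r _ => hd r) (hcont.neg.intervalIntegrable _ _)
  rw [intervalIntegral.integral_neg, hR] at h
  simpa using h

lemma integral_inv_mul_dbar {ψ : ℂ → ℂ} (hψ : ContDiff ℝ 1 ψ) (hc : HasCompactSupport ψ) (z : ℂ) :
    ∫ w, w⁻¹ * dbar ψ (z - w) = Real.pi * ψ z := by
  obtain ⟨R, hR0, hR⟩ : ∃ R : ℝ, 0 < R ∧ ∀ w : ℂ, R ≤ ‖w‖ → ψ (z - w) = 0 ∧ dbar ψ (z - w) = 0 := by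
    obtain ⟨R, hR⟩ := hc.isCompact.isBounded.subset_closedBall 0
    refine ⟨max 1 (R + ‖z‖ + 1), by positivity, fun w hw => ?_⟩
    have hnot : z - w ∉ tsupport ψ := by
      intro h
      have h1 := hR h
      rw [mem_closedBall_zero_iff] at h1
      have h2 : ‖w‖ ≤ ‖z‖ + ‖z - w‖ := by
        have := norm_sub_le z (z - w); simpa using this
      have := (le_max_right _ _).trans hw
      linarith
    refine ⟨image_eq_zero_of_notMem_tsupport hnot, ?_⟩
    have h3 : fderiv ℝ ψ (z - w) = 0 :=
      image_eq_zero_of_notMem_tsupport fun h => hnot (tsupport_fderiv_subset ℝ h)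
    simp [dbar, h3]
  set e : ℝ → ℂ := fun θ => Complex.exp (θ * Complex.I) with he
  have hec : Continuous e := by fun_prop
  have hen : ∀ θ, ‖e θ‖ = 1 := fun θ => Complex.norm_exp_ofReal_mul_I θ
  have hdc := hψ.continuous_fderiv one_ne_zero
  set k : ℝ × ℝ → ℂ := fun p => (1 / 2 : ℂ) * (fderiv ℝ ψ (z - p.1 * e p.2) (e p.2) +
    Complex.I * fderiv ℝ ψ (z - p.1 * e p.2) (Complex.I * e p.2)) with hk
  have hkc : Continuous k := by
    have h1 : Continuous fun p : ℝ × ℝ => fderiv ℝ ψ (z - p.1 * e p.2) :=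
      hdc.comp (by fun_prop)
    exact continuous_const.mul ((h1.clm_apply (by fun_prop)).add
      (continuous_const.mul (h1.clm_apply (by fun_prop))))
  have hpt : ∀ p ∈ polarCoord.target, p.1 • ((Complex.polarCoord.symm p)⁻¹ *
      dbar ψ (z - Complex.polarCoord.symm p)) = (Iic R ×ˢ univ).indicator k p := by
    rintro ⟨r, θ⟩ hp
    have hr : 0 < r := by simpa [polarCoord] using hp.1
    have hsym : Complex.polarCoord.symm (r, θ) = r * e θ := by
      rw [Complex.polarCoord_symm_apply, he]
      simp only [Complex.exp_mul_I]
      push_cast; ring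
    rw [hsym]
    have hval : (r : ℝ) • (((r : ℂ) * e θ)⁻¹ * dbar ψ (z - r * e θ)) = k (r, θ) := by
      have hr' : (r : ℂ) ≠ 0 := by exact_mod_cast hr.ne'
      have he0 : e θ ≠ 0 := Complex.exp_ne_zero _
      set L := fderiv ℝ ψ (z - r * e θ) with hL
      have hlin : ∀ v : ℂ, L v = v.re * L 1 + v.im * L Complex.I := by
        intro v
        conv_lhs => rw [show v = v.re • (1 : ℂ) + v.im • Complex.I by
          rw [Complex.real_smul, Complex.real_smul, mul_one, Complex.re_add_im]]
        rw [map_add, map_smul, map_smul, Complex.real_smul, Complex.real_smul]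
      have hcs : (e θ).re ^ 2 + (e θ).im ^ 2 = 1 := by
        have := Complex.sq_norm (e θ)
        rw [hen, Complex.normSq_apply] at this
        linarith
      have hinv : (e θ)⁻¹ = (e θ).re - (e θ).im * Complex.I := by
        rw [Complex.inv_def, Complex.normSq_apply]
        have : (e θ).re * (e θ).re + (e θ).im * (e θ).im = 1 := by linarith
        rw [this]
        apply Complex.ext <;> simp
      have hk1 : k (r, θ) = (1 / 2 : ℂ) * (L (e θ) + Complex.I * L (Complex.I * e θ)) := rfl
      rw [hk1, hlin (e θ), hlin (Complex.I * e θ), Complex.real_smul, mul_inv, hinv, dbar, ← hL]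
      have hre : (Complex.I * e θ).re = -(e θ).im := by simp
      have him : (Complex.I * e θ).im = (e θ).re := by simp
      rw [hre, him]
      field_simp
      push_cast
      linear_combination (-(e θ).im * L Complex.I) * Complex.I_mul_I
    by_cases h : r ≤ R
    · rw [indicator_of_mem (by simpa using h), hval]
    · rw [indicator_of_notMem (by simpa using h), (hR (r * e θ) ?_).2]
      · simp
      · rw [norm_mul, hen, Complex.norm_real, Real.norm_of_nonneg hr.le]; linarith
  rw [← Complex.integral_comp_polarCoord_symm,
    setIntegral_congr_fun polarCoord.open_target.measurableSet hpt,
    setIntegral_indicator (measurableSet_Iic.prod MeasurableSet.univ)]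
  have hset : polarCoord.target ∩ Iic R ×ˢ univ = Ioc 0 R ×ˢ Ioo (-Real.pi) Real.pi := by
    ext ⟨r, θ⟩; simp [polarCoord]; tauto
  have hpi : -Real.pi ≤ Real.pi := by linarith [Real.pi_pos]
  have hint : IntegrableOn k (Ioc 0 R ×ˢ Ioo (-Real.pi) Real.pi) :=
    (hkc.continuousOn.integrableOn_compact (isCompact_Icc.prod isCompact_Icc)).mono_set
      (prod_mono Ioc_subset_Icc_self Ioo_subset_Icc_self)
  rw [hset, Measure.volume_eq_prod, setIntegral_prod _ hint]
  have hinner : ∀ r ∈ Ioc (0 : ℝ) R, ∫ θ in Ioo (-Real.pi) Real.pi, k (r, θ) =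
      ∫ θ in Ioo (-Real.pi) Real.pi, (1 / 2 : ℂ) * fderiv ℝ ψ (z - r * e θ) (e θ) := by
    intro r hr
    rw [← integral_Ioc_eq_integral_Ioo, ← integral_Ioc_eq_integral_Ioo,
      ← intervalIntegral.integral_of_le hpi, ← intervalIntegral.integral_of_le hpi]
    have h1 : Continuous fun θ : ℝ => fderiv ℝ ψ (z - r * e θ) := hdc.comp (by fun_prop)
    have h2 : Continuous fun θ : ℝ => fderiv ℝ ψ (z - r * e θ) (e θ) := h1.clm_apply hec
    have h3 : Continuous fun θ : ℝ => fderiv ℝ ψ (z - r * e θ) (Complex.I * e θ) :=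
      h1.clm_apply (by fun_prop)
    have h4 : Continuous fun θ : ℝ =>
        Complex.I * fderiv ℝ ψ (z - r * e θ) (Complex.I * e θ) := continuous_const.mul h3
    simp only [hk]
    rw [intervalIntegral.integral_const_mul, intervalIntegral.integral_const_mul,
      intervalIntegral.integral_add (h2.intervalIntegrable _ _) (h4.intervalIntegrable _ _),
      intervalIntegral.integral_const_mul, circle_integral_tangential hψ z hr.1]
    simp
  rw [setIntegral_congr_fun measurableSet_Ioc hinner]
  have hrc : Continuous (fun p : ℝ × ℝ => (1 / 2 : ℂ) * fderiv ℝ ψ (z - p.1 * e p.2) (e p.2)) :=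
    continuous_const.mul ((hdc.comp (by fun_prop)).clm_apply (by fun_prop))
  rw [integral_integral_swap (f := fun (r θ : ℝ) => (1 / 2 : ℂ) * fderiv ℝ ψ (z - r * e θ) (e θ))]
  · have hrad : ∀ θ, ∫ r in Ioc 0 R, (1 / 2 : ℂ) * fderiv ℝ ψ (z - r * e θ) (e θ) =
        (1 / 2 : ℂ) * ψ z := by
      intro θ
      rw [← intervalIntegral.integral_of_le hR0.le, intervalIntegral.integral_const_mul,
        radial_integral hψ]
      refine (hR _ ?_).1
      rw [norm_mul, hen, Complex.norm_real, Real.norm_of_nonneg hR0.le, mul_one]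
    simp only [hrad]
    rw [setIntegral_const, Measure.real, Real.volume_Ioo, ENNReal.toReal_ofReal (by linarith),
      Complex.real_smul]
    push_cast; ring
  · rw [Measure.prod_restrict]
    exact (hrc.continuousOn.integrableOn_compact (isCompact_Icc.prod isCompact_Icc)).mono_set
      (prod_mono Ioc_subset_Icc_self Ioo_subset_Icc_self)

lemma hasFDerivAt_cauchyTransform {ψ : ℂ → ℂ} (hψ : ContDiff ℝ 1 ψ) (hc : HasCompactSupport ψ)
    (z : ℂ) : DifferentiableAt ℝ (cauchyTransform ψ) z ∧ dbar (cauchyTransform ψ) z = ψ z := by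
  have h := (hc.hasFDerivAt_convolution_right (ContinuousLinearMap.mul ℝ ℂ)
    locallyIntegrable_inv hψ z).const_mul ((Real.pi : ℂ)⁻¹)
  have hfun : (fun y => (Real.pi : ℂ)⁻¹ * convolution (fun z : ℂ => z⁻¹) ψ
      (ContinuousLinearMap.mul ℝ ℂ) volume y) = cauchyTransform ψ := by
    ext y; rfl
  rw [hfun] at h
  refine ⟨h.differentiableAt, ?_⟩
  have hconv : ConvolutionExistsAt (fun z : ℂ => z⁻¹) (fderiv ℝ ψ) z
      ((ContinuousLinearMap.mul ℝ ℂ).precompR ℂ) volume :=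
    (hc.fderiv ℝ).convolutionExists_right _ locallyIntegrable_inv
      (hψ.continuous_fderiv one_ne_zero) z
  have hval : ∀ v : ℂ, (convolution (fun z : ℂ => z⁻¹) (fderiv ℝ ψ)
      ((ContinuousLinearMap.mul ℝ ℂ).precompR ℂ) volume z) v =
      ∫ w, w⁻¹ * fderiv ℝ ψ (z - w) v := by
    intro v
    rw [convolution_def, ContinuousLinearMap.integral_apply hconv]
    simp
  have hint : ∀ v : ℂ, Integrable fun w => w⁻¹ * fderiv ℝ ψ (z - w) v := by
    intro v
    have := hconv.integrable.apply_continuousLinearMap v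
    simpa using this
  rw [dbar, h.fderiv]
  simp only [FunLike.coe_smul, Pi.smul_apply, hval, smul_eq_mul]
  have : ∫ w, w⁻¹ * dbar ψ (z - w) = (1 / 2 : ℂ) * ((∫ w, w⁻¹ * fderiv ℝ ψ (z - w) 1) +
      Complex.I * ∫ w, w⁻¹ * fderiv ℝ ψ (z - w) Complex.I) := by
    rw [← integral_const_mul, ← integral_add (hint 1) ((hint _).const_mul _), ← integral_const_mul]
    refine integral_congr_ae (Eventually.of_forall fun w => ?_)
    simp only [dbar]
    ring
  rw [integral_inv_mul_dbar hψ hc z] at this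
  have hpi : (Real.pi : ℂ) ≠ 0 := by exact_mod_cast Real.pi_ne_zero
  calc _ = (Real.pi : ℂ)⁻¹ * ((1 / 2 : ℂ) * ((∫ w, w⁻¹ * fderiv ℝ ψ (z - w) 1) +
      Complex.I * ∫ w, w⁻¹ * fderiv ℝ ψ (z - w) Complex.I)) := by ring
    _ = ψ z := by rw [← this, inv_mul_cancel_left₀ hpi]

section Regularised

variable {G H : ℂ → ℂ} {δ : ℝ}

/-- The regularised square modulus `|G|² + δ²`. -/
def regSq (G : ℂ → ℂ) (δ : ℝ) (z : ℂ) : ℝ := ‖G z‖ ^ 2 + δ ^ 2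

lemma regSq_pos (hδ : 0 < δ) (z : ℂ) : 0 < regSq G δ z := by
  unfold regSq; positivity

lemma norm_sq_le_regSq (z : ℂ) : ‖G z‖ ^ 2 ≤ regSq G δ z := by
  unfold regSq; nlinarith [sq_nonneg δ]

lemma sq_le_regSq (z : ℂ) : δ ^ 2 ≤ regSq G δ z := by
  unfold regSq; nlinarith [sq_nonneg ‖G z‖]

lemma contDiff_regSq (hG : Differentiable ℂ G) : ContDiff ℝ 2 (regSq G δ) := by
  have h : ContDiff ℝ 2 G := hG.contDiff.restrict_scalars ℝ
  exact (h.norm_sq ℝ).add contDiff_const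

lemma contDiff_conj_comp (hG : Differentiable ℂ G) :
    ContDiff ℝ 2 fun w => (starRingEnd ℂ) (G w) :=
  Complex.conjCLE.contDiff.comp (hG.contDiff.restrict_scalars ℝ)

lemma dbar_regSq (hG : Differentiable ℂ G) (z : ℂ) :
    dbar (fun w => (regSq G δ w : ℂ)) z = G z * (starRingEnd ℂ) (deriv G z) := by
  have h : (fun w => (regSq G δ w : ℂ)) =
      fun w => G w * (starRingEnd ℂ) (G w) - (-(δ : ℂ) ^ 2) := by
    ext w
    rw [Complex.mul_conj', regSq]
    push_cast; ring
  have hGr : DifferentiableAt ℝ G z := (hG z).restrictScalars ℝ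
  have hGc : DifferentiableAt ℝ (fun w => (starRingEnd ℂ) (G w)) z :=
    (contDiff_conj_comp hG).differentiable two_ne_zero z
  rw [h, dbar_sub (hGr.fun_mul hGc) (differentiableAt_const _), dbar_mul hGr hGc,
    dbar_of_differentiableAt (hG z), dbar_conj (hG z),
    dbar_of_differentiableAt (differentiableAt_const _)]
  ring

lemma dbar_regSq_rpow (hG : Differentiable ℂ G) (hδ : 0 < δ) (p : ℝ) (z : ℂ) :
    dbar (fun w => ((regSq G δ w ^ p : ℝ) : ℂ)) z =
      ((p * regSq G δ z ^ (p - 1) : ℝ) : ℂ) * (G z * (starRingEnd ℂ) (deriv G z)) := by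
  rw [dbar_ofReal_comp (φ := fun x => x ^ p) ((contDiff_regSq hG).differentiable two_ne_zero z)
    (Real.hasDerivAt_rpow_const (Or.inl (regSq_pos hδ z).ne')), dbar_regSq hG]

lemma contDiff_regSq_rpow (hG : Differentiable ℂ G) (hδ : 0 < δ) (p : ℝ) :
    ContDiff ℝ 2 fun w => ((regSq G δ w ^ p : ℝ) : ℂ) :=
  Complex.ofRealCLM.contDiff.comp
    ((contDiff_regSq hG).rpow_const_of_ne fun z => (regSq_pos hδ z).ne')

/-- A smooth substitute for the quotient `H / G`. -/
def regQuot (G H : ℂ → ℂ) (δ : ℝ) (z : ℂ) : ℂ :=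
  H z * ((starRingEnd ℂ) (G z) * ((regSq G δ z ^ (-1 : ℝ) : ℝ) : ℂ))

lemma differentiableAt_regQuot (hG : Differentiable ℂ G) (hH : Differentiable ℂ H) (hδ : 0 < δ)
    (z : ℂ) : DifferentiableAt ℝ (regQuot G H δ) z :=
  ((hH z).restrictScalars ℝ).mul (((contDiff_conj_comp hG).differentiable two_ne_zero z).mul
    ((contDiff_regSq_rpow hG hδ _).differentiable two_ne_zero z))

lemma dbar_regQuot (hG : Differentiable ℂ G) (hH : Differentiable ℂ H) (hδ : 0 < δ) (z : ℂ) :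
    dbar (regQuot G H δ) z =
      H z * (starRingEnd ℂ) (deriv G z) * ((δ ^ 2 * regSq G δ z ^ (-2 : ℝ) : ℝ) : ℂ) := by
  have hGc : DifferentiableAt ℝ (fun w => (starRingEnd ℂ) (G w)) z :=
    (contDiff_conj_comp hG).differentiable two_ne_zero z
  have hSp : DifferentiableAt ℝ (fun w => ((regSq G δ w ^ (-1 : ℝ) : ℝ) : ℂ)) z :=
    (contDiff_regSq_rpow hG hδ _).differentiable two_ne_zero z
  unfold regQuot
  rw [dbar_mul ((hH z).restrictScalars ℝ) (hGc.fun_mul hSp), dbar_mul hGc hSp,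
    dbar_of_differentiableAt (hH z), dbar_conj (hG z), dbar_regSq_rpow hG hδ]
  have hS := regSq_pos (G := G) hδ z
  have h1 : regSq G δ z ^ (-1 : ℝ) = regSq G δ z * regSq G δ z ^ (-2 : ℝ) := by
    rw [← Real.rpow_one_add' hS.le (by norm_num)]; norm_num
  rw [h1, show (-1 - 1 : ℝ) = -2 by norm_num]
  have h2 : (regSq G δ z : ℂ) = G z * (starRingEnd ℂ) (G z) + (δ : ℂ) ^ 2 := by
    rw [Complex.mul_conj', regSq]; push_cast; ring
  push_cast
  rw [h2]
  ring

lemma dbar_energy (hG : Differentiable ℂ G) (hδ : 0 < δ) (a : ℝ) (z : ℂ) :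
    dbar (fun w => deriv G w * ((starRingEnd ℂ) (G w) * ((regSq G δ w ^ (a - 1) : ℝ) : ℂ))) z =
      ((‖deriv G z‖ ^ 2 * regSq G δ z ^ (a - 2) * (δ ^ 2 + a * ‖G z‖ ^ 2) : ℝ) : ℂ) := by
  have hG' : Differentiable ℂ (deriv G) := (hG.contDiff (n := 2)).differentiable_deriv_two
  have hGc : DifferentiableAt ℝ (fun w => (starRingEnd ℂ) (G w)) z :=
    (contDiff_conj_comp hG).differentiable two_ne_zero z
  have hSp : DifferentiableAt ℝ (fun w => ((regSq G δ w ^ (a - 1) : ℝ) : ℂ)) z :=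
    (contDiff_regSq_rpow hG hδ _).differentiable two_ne_zero z
  rw [dbar_mul ((hG' z).restrictScalars ℝ) (hGc.fun_mul hSp), dbar_mul hGc hSp,
    dbar_of_differentiableAt (hG' z), dbar_conj (hG z), dbar_regSq_rpow hG hδ]
  have hS := regSq_pos (G := G) hδ z
  have h1 : regSq G δ z ^ (a - 1) = regSq G δ z * regSq G δ z ^ (a - 2) := by
    rw [show a - 1 = a - 2 + 1 by ring, Real.rpow_add_one hS.ne', mul_comm]
  rw [h1, show (a - 1 - 1 : ℝ) = a - 2 by ring]
  have h2 : (regSq G δ z : ℂ) = G z * (starRingEnd ℂ) (G z) + (δ : ℂ) ^ 2 := by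
    rw [Complex.mul_conj', regSq]; push_cast; ring
  push_cast
  rw [h2, ← Complex.mul_conj', ← Complex.mul_conj']
  ring

end Regularised

/-- A fixed cutoff function on the plane. -/
def cutoff : ContDiffBump (0 : ℂ) := ⟨1 / 2, 3 / 4, by norm_num, by norm_num⟩

lemma cutoff_eq_zero {z : ℂ} (hz : 3 / 4 ≤ ‖z‖) : cutoff z = 0 :=
  cutoff.zero_of_le_dist (by simpa [cutoff] using hz)

lemma cutoff_eq_one {z : ℂ} (hz : ‖z‖ ≤ 1 / 2) : cutoff z = 1 :=
  cutoff.one_of_mem_closedBall (by simpa [cutoff] using hz)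

lemma contDiff_cutoff : ContDiff ℝ 2 fun z => (cutoff z : ℂ) :=
  Complex.ofRealCLM.contDiff.comp cutoff.contDiff

lemma dbar_cutoff_eq_zero {z : ℂ} (hz : 3 / 4 < ‖z‖) : dbar (fun z => (cutoff z : ℂ)) z = 0 := by
  have h : (fun z => (cutoff z : ℂ)) =ᶠ[𝓝 z] fun _ => 0 := by
    filter_upwards [continuous_norm.continuousAt.eventually (lt_mem_nhds hz)] with w hw
    simp [cutoff_eq_zero hw.le]
  simp [dbar, h.fderiv_eq]

lemma continuous_dbar {f : ℂ → ℂ} (hf : ContDiff ℝ 1 f) : Continuous (dbar f) := by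
  have hd : Continuous (fderiv ℝ f) := hf.continuous_fderiv one_ne_zero
  unfold dbar
  exact continuous_const.mul ((hd.clm_apply continuous_const).add
    (continuous_const.mul (hd.clm_apply continuous_const)))

lemma hasCompactSupport_of_eq_zero {F : Type*} [Zero F] {f : ℂ → F} {R : ℝ}
    (h : ∀ z, R < ‖z‖ → f z = 0) : HasCompactSupport f :=
  HasCompactSupport.of_support_subset_isCompact (isCompact_closedBall (0 : ℂ) R) fun z hz => by
    by_contra hc
    exact hz (h z (by simpa using hc))

/-- The density controlling `∂̄` of the regularised quotient. -/
def energyDensity (G : ℂ → ℂ) (δ a : ℝ) (z : ℂ) : ℝ :=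
  cutoff z * ‖deriv G z‖ * δ * regSq G δ z ^ (a / 2 - 1)

lemma energyDensity_nonneg {G : ℂ → ℂ} {δ a : ℝ} (hδ : 0 < δ) (z : ℂ) :
    0 ≤ energyDensity G δ a z := by
  have := regSq_pos (G := G) hδ z
  have := cutoff.nonneg' z
  unfold energyDensity
  positivity

lemma continuous_energyDensity {G : ℂ → ℂ} {δ a : ℝ} (hG : Differentiable ℂ G) (hδ : 0 < δ) :
    Continuous (energyDensity G δ a) := by
  have hG' : Continuous (deriv G) := hG.contDiff.continuous_deriv_one
  unfold energyDensity
  refine ((cutoff.continuous.mul hG'.norm).mul continuous_const).mul ?_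
  exact (contDiff_regSq hG).continuous.rpow_const fun z => Or.inl (regSq_pos hδ z).ne'

lemma energyDensity_eq_zero {G : ℂ → ℂ} {δ a : ℝ} {z : ℂ} (hz : 3 / 4 ≤ ‖z‖) :
    energyDensity G δ a z = 0 := by
  simp [energyDensity, cutoff_eq_zero hz]

lemma integral_energyDensity_sq_le {a A δ : ℝ} (ha : 0 < a) (ha1 : a ≤ 1) (hA : 1 ≤ A)
    (hδ : 0 < δ) (hδ1 : δ ≤ 1) {G : ℂ → ℂ} (hG : Differentiable ℂ G)
    (hGA : ∀ z ∈ ball (0 : ℂ) 1, ‖G z‖ ≤ A) :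
    ∫ z, energyDensity G δ a z ^ 2 ≤
      ∫ z, 2 * A ^ 2 / a * ‖dbar (fun z => (cutoff z : ℂ)) z‖ ^ 2 := by
  set χ : ℂ → ℂ := fun z => (cutoff z : ℂ) with hχ
  set X : ℂ → ℂ := fun w => deriv G w * ((starRingEnd ℂ) (G w) * ((regSq G δ w ^ (a - 1) : ℝ) : ℂ))
    with hX
  have hG'd : Differentiable ℂ (deriv G) := (hG.contDiff (n := 2)).differentiable_deriv_two
  have hχd : ContDiff ℝ 2 χ := contDiff_cutoff
  have hXd : ContDiff ℝ 2 X := (hG'd.contDiff.restrict_scalars ℝ).mul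
    ((contDiff_conj_comp hG).mul (contDiff_regSq_rpow hG hδ _))
  have hYd : ContDiff ℝ 1 fun w => (χ w * χ w) * X w := ((hχd.mul hχd).mul hXd).of_le (by norm_num)
  have hYc : HasCompactSupport fun w => (χ w * χ w) * X w :=
    hasCompactSupport_of_eq_zero (R := 3 / 4) fun z hz => by simp [hχ, cutoff_eq_zero hz.le]
  have h0 := integral_dbar_eq_zero hYd hYc
  have hdY : HasCompactSupport (dbar fun w => (χ w * χ w) * X w) :=
    hasCompactSupport_of_eq_zero (R := 3 / 4) fun z hz => by
      have h : (fun w => (χ w * χ w) * X w) =ᶠ[𝓝 z] fun _ => 0 := by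
        filter_upwards [continuous_norm.continuousAt.eventually (lt_mem_nhds hz)] with w hw
        simp [hχ, cutoff_eq_zero hw.le]
      simp [dbar, h.fderiv_eq]
  have hYi := (continuous_dbar hYd).integrable_of_hasCompactSupport (μ := volume) hdY
  have hre : ∫ z, (dbar (fun w => (χ w * χ w) * X w) z).re = 0 := by
    have := integral_re hYi
    simp only [RCLike.re_to_complex] at this
    rw [this, h0]; simp
  have hri : Integrable fun z => (dbar (fun w => (χ w * χ w) * X w) z).re := hYi.re
  have hvi : Integrable fun z => energyDensity G δ a z ^ 2 :=
    ((continuous_energyDensity hG hδ).pow 2).integrable_of_hasCompactSupport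
      (hasCompactSupport_of_eq_zero (R := 3 / 4) fun z hz => by
        simp [energyDensity_eq_zero hz.le])
  have hbi : Integrable fun z => 2 * A ^ 2 / a * ‖dbar χ z‖ ^ 2 :=
    (continuous_const.mul ((continuous_dbar (hχd.of_le (by norm_num))).norm.pow
      2)).integrable_of_hasCompactSupport
      (hasCompactSupport_of_eq_zero (R := 3 / 4) fun z hz => by
        simp [hχ, dbar_cutoff_eq_zero hz])
  have hpt : ∀ z, energyDensity G δ a z ^ 2 ≤ (dbar (fun w => (χ w * χ w) * X w) z).re +
      2 * A ^ 2 / a * ‖dbar χ z‖ ^ 2 := by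
    intro z
    have hχz := hχd.differentiable two_ne_zero z
    have hS := regSq_pos (G := G) hδ z
    set S := regSq G δ z with hSdef
    set T := S ^ (a - 2) with hT
    have hT0 : 0 < T := by positivity
    have hS1 : S ^ (a - 1) = S * T := by
      rw [hT, show a - 1 = a - 2 + 1 by ring, Real.rpow_add_one hS.ne', mul_comm]
    have hS2 : S ^ a = S ^ 2 * T := by
      rw [hT, ← Real.rpow_natCast, ← Real.rpow_add hS]; congr 1; push_cast; ring
    have hv : energyDensity G δ a z ^ 2 = cutoff z ^ 2 * ‖deriv G z‖ ^ 2 * δ ^ 2 * T := by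
      rw [energyDensity, mul_pow, mul_pow, mul_pow, ← hSdef, ← Real.rpow_natCast (S ^ _),
        ← Real.rpow_mul hS.le, hT]
      congr 2; push_cast; ring
    rw [dbar_mul (hχz.fun_mul hχz) (hXd.differentiable two_ne_zero z), dbar_mul hχz hχz,
      dbar_energy hG hδ, ← hSdef, ← hT, hv]
    have hlow : -(2 * cutoff z * ‖dbar χ z‖ * (‖deriv G z‖ * ‖G z‖ * (S * T))) ≤
        ((dbar χ z * χ z + χ z * dbar χ z) * X z).re := by
      refine neg_le_of_abs_le ((Complex.abs_re_le_norm _).trans ?_)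
      have h1 : ‖X z‖ = ‖deriv G z‖ * ‖G z‖ * (S * T) := by
        simp only [hX]
        rw [norm_mul, norm_mul, RCLike.norm_conj, Complex.norm_real, ← hSdef, hS1,
          Real.norm_of_nonneg (by positivity)]
        ring
      rw [norm_mul, h1, show dbar χ z * χ z + χ z * dbar χ z = 2 * χ z * dbar χ z by ring, norm_mul,
        norm_mul, hχ]
      simp only [Complex.norm_real, Real.norm_of_nonneg (cutoff.nonneg' z)]
      rw [Complex.norm_ofNat]
    have hmain : (χ z * χ z * ((‖deriv G z‖ ^ 2 * T * (δ ^ 2 + a * ‖G z‖ ^ 2) : ℝ) : ℂ)).re =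
        cutoff z ^ 2 * (‖deriv G z‖ ^ 2 * T * (δ ^ 2 + a * ‖G z‖ ^ 2)) := by
      simp only [hχ, ← Complex.ofReal_mul, Complex.ofReal_re]; ring
    have hSa : ‖dbar χ z‖ ^ 2 * (S ^ 2 * T) ≤ ‖dbar χ z‖ ^ 2 * (2 * A ^ 2) := by
      rcases le_or_gt ‖z‖ (3 / 4) with hz | hz
      · refine mul_le_mul_of_nonneg_left ?_ (by positivity)
        rw [← hS2]
        have hS3 : S ≤ 2 * A ^ 2 := by
          have := hGA z (by simp; linarith)
          have h5 : ‖G z‖ ^ 2 ≤ A ^ 2 := by gcongr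
          have h6 : δ ^ 2 ≤ 1 := by nlinarith
          rw [hSdef, regSq]; nlinarith
        calc S ^ a ≤ (2 * A ^ 2) ^ a := by gcongr
          _ ≤ (2 * A ^ 2) ^ (1 : ℝ) := Real.rpow_le_rpow_of_exponent_le (by nlinarith) ha1
          _ = _ := Real.rpow_one _
      · simp [hχ, dbar_cutoff_eq_zero hz]
    rw [Complex.add_re, hmain]
    set c := cutoff z
    set b := ‖dbar χ z‖
    set g' := ‖deriv G z‖
    set g := ‖G z‖
    have hsq : 0 ≤ T / a * (a * c * g' * g - b * S) ^ 2 := by positivity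
    have hsq2 : T / a * (a * c * g' * g - b * S) ^ 2 =
        a * c ^ 2 * g' ^ 2 * g ^ 2 * T - 2 * c * b * (g' * g * (S * T)) + b ^ 2 * (S ^ 2 * T) / a := by
      field_simp
      ring
    have hSa' : b ^ 2 * (S ^ 2 * T) / a ≤ 2 * A ^ 2 / a * b ^ 2 := by
      rw [div_mul_eq_mul_div]
      gcongr ?_ / a
      linarith
    nlinarith
  calc ∫ z, energyDensity G δ a z ^ 2 ≤ ∫ z, ((dbar (fun w => (χ w * χ w) * X w) z).re +
      2 * A ^ 2 / a * ‖dbar χ z‖ ^ 2) := integral_mono hvi (hri.add hbi) hpt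
    _ = _ := by
      rw [integral_add hri hbi, hre, zero_add]

lemma norm_le_regSq_rpow {j : ℕ} (hj : 1 ≤ j) {A δ : ℝ} (hA : 1 ≤ A) (hδ : 0 < δ) {G : ℂ → ℂ}
    {b z : ℂ} (h : ‖G z ^ (j + 1) - b ^ j‖ ≤ A * δ ^ (j + 1)) :
    ‖b‖ ≤ 2 * A * regSq G δ z ^ ((1 : ℝ) / 2 + 1 / (2 * j)) := by
  have hS := regSq_pos (G := G) hδ z
  set S := regSq G δ z with hSdef
  have hj0 : (0 : ℝ) < j := by exact_mod_cast hj
  have hg : ‖G z‖ ≤ √S := Real.le_sqrt_of_sq_le (norm_sq_le_regSq z)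
  have hd : δ ≤ √S := Real.le_sqrt_of_sq_le (sq_le_regSq z)
  have h1 : ‖b‖ ^ j ≤ 2 * A * √S ^ (j + 1) := by
    have h2 : ‖b ^ j‖ ≤ ‖G z ^ (j + 1)‖ + ‖G z ^ (j + 1) - b ^ j‖ := by
      have := norm_sub_le (G z ^ (j + 1)) (G z ^ (j + 1) - b ^ j)
      simpa using this
    rw [norm_pow, norm_pow] at h2
    have h3 : ‖G z‖ ^ (j + 1) ≤ √S ^ (j + 1) := by gcongr
    have h4 : δ ^ (j + 1) ≤ √S ^ (j + 1) := by gcongr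
    have h5 : 0 ≤ √S ^ (j + 1) := by positivity
    nlinarith
  have h6 : √S ^ (j + 1) = (S ^ ((1 : ℝ) / 2 + 1 / (2 * j))) ^ j := by
    rw [Real.sqrt_eq_rpow, ← Real.rpow_natCast, ← Real.rpow_natCast, ← Real.rpow_mul hS.le,
      ← Real.rpow_mul hS.le]
    congr 1
    push_cast
    field_simp
  refine le_of_pow_le_pow_left₀ (by omega : j ≠ 0) (by positivity) (h1.trans ?_)
  rw [mul_pow, h6]
  gcongr
  exact le_self_pow₀ (by linarith) (by omega)

lemma norm_regQuot_le {A δ a : ℝ} (hδ : 0 < δ) {G H : ℂ → ℂ} {z : ℂ}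
    (h : ‖H z‖ ≤ A * regSq G δ z ^ ((1 : ℝ) / 2 + a)) :
    ‖regQuot G H δ z‖ ≤ A * regSq G δ z ^ a := by
  have hS := regSq_pos (G := G) hδ z
  have hg : ‖G z‖ ≤ regSq G δ z ^ ((1 : ℝ) / 2) := by
    rw [← Real.sqrt_eq_rpow]; exact Real.le_sqrt_of_sq_le (norm_sq_le_regSq z)
  set S := regSq G δ z
  have hA : 0 ≤ A * S ^ ((1 : ℝ) / 2 + a) := (norm_nonneg _).trans h
  rw [regQuot, norm_mul, norm_mul, RCLike.norm_conj, Complex.norm_real,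
    Real.norm_of_nonneg (by positivity)]
  calc ‖H z‖ * (‖G z‖ * S ^ (-1 : ℝ)) ≤
      (A * S ^ ((1 : ℝ) / 2 + a)) * (S ^ ((1 : ℝ) / 2) * S ^ (-1 : ℝ)) := by gcongr
    _ = A * S ^ a := by
      rw [mul_assoc, ← Real.rpow_add hS, ← Real.rpow_add hS]
      congr 2; ring

lemma div_le_sq_add {v t B s : ℝ} (hv : 0 ≤ v) (ht : 0 < t) (hvB : v ≤ B) (hs : 0 < s)
    (hs1 : s < 1) : t⁻¹ * v ≤ v ^ 2 + B ^ s * t ^ (-2 + s) := by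
  rcases le_total t⁻¹ v with h | h
  · have : t⁻¹ * v ≤ v ^ 2 := by nlinarith
    have h2 : 0 ≤ B ^ s * t ^ (-2 + s) := by have := hv.trans hvB; positivity
    linarith
  · have h1 : v = v ^ s * v ^ (1 - s) := by
      rw [← Real.rpow_add' hv (by norm_num)]; norm_num
    have h2 : t ^ (-2 + s) = t⁻¹ ^ (1 - s) * t⁻¹ := by
      rw [← Real.rpow_add_one (by positivity), Real.inv_rpow ht.le, ← Real.rpow_neg ht.le]
      congr 1; ring
    have h3 : v ^ s * v ^ (1 - s) ≤ B ^ s * t⁻¹ ^ (1 - s) := by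
      have : 0 ≤ 1 - s := by linarith
      have := hv.trans hvB
      gcongr
    have h4 : v * t⁻¹ ≤ B ^ s * t⁻¹ ^ (1 - s) * t⁻¹ := by
      rw [← h1] at h3
      gcongr
    rw [h2]
    nlinarith [sq_nonneg v]

lemma norm_deriv_le {G : ℂ → ℂ} (hG : Differentiable ℂ G) {A : ℝ}
    (hGA : ∀ z ∈ ball (0 : ℂ) 1, ‖G z‖ ≤ A) {z : ℂ} (hz : ‖z‖ ≤ 3 / 4) :
    ‖deriv G z‖ ≤ 8 * A := by
  have := Complex.norm_deriv_le_of_forall_mem_sphere_norm_le (c := z) (R := 1 / 8) (C := A)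
    (f := G) (by norm_num) (hG.diffContOnCl) (fun w hw => hGA w ?_)
  · rw [div_div_eq_mul_div] at this; linarith
  · rw [mem_sphere_iff_norm] at hw
    rw [mem_ball_zero_iff]
    have := norm_le_insert' w z
    linarith

lemma norm_cauchyTransform_le {A δ a : ℝ} (ha : 0 < a) (ha1 : a ≤ 1) (hA : 1 ≤ A)
    (hδ : 0 < δ) (hδ1 : δ ≤ 1) {G ψ : ℂ → ℂ} (hG : Differentiable ℂ G)
    (hGA : ∀ z ∈ ball (0 : ℂ) 1, ‖G z‖ ≤ A)
    (h : ∀ z, ‖ψ z‖ ≤ 2 * A * δ ^ a * energyDensity G δ a z) {z : ℂ} (hz : ‖z‖ < 1) :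
    ‖cauchyTransform ψ z‖ ≤ (2 * A * ((∫ z, 2 * A ^ 2 / a * ‖dbar (fun z => (cutoff z : ℂ)) z‖ ^ 2) +
      8 * A * ∫ w in ball (0 : ℂ) 2, ‖w‖ ^ (-2 + a / 2))) * δ ^ (a / 2) := by
  have hv : ∀ w, energyDensity G δ a w ≤ 8 * A / δ := by
    intro w
    rcases le_total (3 / 4) ‖w‖ with hw | hw
    · rw [energyDensity_eq_zero hw]; positivity
    have hS := regSq_pos (G := G) hδ w
    have h1 : regSq G δ w ^ (a / 2 - 1) ≤ δ⁻¹ ^ 2 := by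
      calc regSq G δ w ^ (a / 2 - 1) ≤ (δ ^ 2) ^ (a / 2 - 1) :=
            Real.rpow_le_rpow_of_nonpos (by positivity) (sq_le_regSq w) (by linarith)
        _ ≤ (δ ^ 2) ^ (-1 : ℝ) :=
            Real.rpow_le_rpow_of_exponent_ge (by positivity) (by nlinarith) (by linarith)
        _ = δ⁻¹ ^ 2 := by rw [Real.rpow_neg_one, inv_pow]
    calc energyDensity G δ a w ≤ 1 * (8 * A) * δ * δ⁻¹ ^ 2 := by
          unfold energyDensity
          gcongr
          · exact cutoff.le_one
          · exact norm_deriv_le hG hGA hw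
      _ = 8 * A / δ := by field_simp
  set e := energyDensity G δ a with he
  have he0 : ∀ w, 0 ≤ e w := energyDensity_nonneg hδ
  have hei : Integrable fun w => e w ^ 2 :=
    ((continuous_energyDensity hG hδ).pow 2).integrable_of_hasCompactSupport
      (hasCompactSupport_of_eq_zero (R := 3 / 4) fun z hz => by
        simp [energyDensity_eq_zero hz.le])
  have hei' : Integrable fun w => e (z - w) ^ 2 := hei.comp_sub_left z
  have hni : Integrable ((ball (0 : ℂ) 2).indicator fun w => ‖w‖ ^ (-2 + a / 2)) :=
    (integrable_indicator_iff measurableSet_ball).2 (integrableOn_norm_rpow (by linarith) 2)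
  have hB : (8 * A / δ) ^ (a / 2) ≤ 8 * A * δ ^ (-(a / 2)) := by
    rw [div_eq_mul_inv, Real.mul_rpow (by positivity) (by positivity), Real.inv_rpow hδ.le,
      ← Real.rpow_neg hδ.le]
    gcongr
    calc (8 * A) ^ (a / 2) ≤ (8 * A) ^ (1 : ℝ) :=
          Real.rpow_le_rpow_of_exponent_le (by linarith) (by linarith)
      _ = 8 * A := Real.rpow_one _
  have hpt : ∀ w : ℂ, ‖w⁻¹ * ψ (z - w)‖ ≤ 2 * A * δ ^ a * (e (z - w) ^ 2 + 8 * A * δ ^ (-(a / 2)) *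
      (ball (0 : ℂ) 2).indicator (fun w => ‖w‖ ^ (-2 + a / 2)) w) := by
    intro w
    have hind : 0 ≤ (ball (0 : ℂ) 2).indicator (fun w => ‖w‖ ^ (-2 + a / 2)) w :=
      indicator_nonneg (fun w _ => by positivity) w
    rcases eq_or_ne w 0 with rfl | hw
    · simp only [inv_zero, zero_mul, norm_zero]; positivity
    rw [norm_mul, norm_inv]
    have hw0 : 0 < ‖w‖ := norm_pos_iff.2 hw
    calc ‖w‖⁻¹ * ‖ψ (z - w)‖ ≤ ‖w‖⁻¹ * (2 * A * δ ^ a * e (z - w)) := by gcongr; exact h _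
      _ = 2 * A * δ ^ a * (‖w‖⁻¹ * e (z - w)) := by ring
      _ ≤ _ := by
        gcongr
        rcases lt_or_ge ‖w‖ 2 with hw2 | hw2
        · rw [indicator_of_mem (by simpa using hw2)]
          refine (div_le_sq_add (he0 _) hw0 (hv _) (s := a / 2) (by linarith) (by linarith)).trans ?_
          gcongr
        · have : e (z - w) = 0 := energyDensity_eq_zero (by
            have := norm_sub_norm_le w z
            rw [norm_sub_rev] at this
            linarith)
          rw [this, mul_zero]
          positivity
  have hδa : δ ^ a = δ ^ (a / 2) * δ ^ (a / 2) := by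
    rw [← Real.rpow_add hδ]; congr 1; ring
  have hδ2 : δ ^ (a / 2) * δ ^ (-(a / 2)) = 1 := by
    rw [← Real.rpow_add hδ]; simp
  have hδ3 : δ ^ (a / 2) ≤ 1 := Real.rpow_le_one hδ.le hδ1 (by linarith)
  have hI1 := integral_energyDensity_sq_le ha ha1 hA hδ hδ1 hG hGA
  set I1 := ∫ z, 2 * A ^ 2 / a * ‖dbar (fun z => (cutoff z : ℂ)) z‖ ^ 2
  set I2 := ∫ w in ball (0 : ℂ) 2, ‖w‖ ^ (-2 + a / 2) with hI2
  have hI1' : 0 ≤ I1 := (integral_nonneg fun w => sq_nonneg _).trans hI1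
  have hI2' : 0 ≤ I2 := integral_nonneg fun w => by positivity
  have hint : ‖∫ w, w⁻¹ * ψ (z - w)‖ ≤ 2 * A * δ ^ a * (I1 + 8 * A * δ ^ (-(a / 2)) * I2) := by
    refine (norm_integral_le_of_norm_le ((hei'.add (hni.const_mul _)).const_mul _)
      (Eventually.of_forall hpt)).trans ?_
    simp only [Pi.add_apply]
    rw [integral_const_mul, integral_add hei' (hni.const_mul _), integral_const_mul,
      integral_indicator measurableSet_ball, integral_sub_left_eq_self (fun w => e w ^ 2) volume z]
    gcongr
  rw [cauchyTransform, norm_mul, norm_inv, Complex.norm_real, Real.norm_of_nonneg Real.pi_pos.le]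
  have hpi : Real.pi⁻¹ ≤ 1 := inv_le_one_of_one_le₀ (by linarith [Real.pi_gt_three])
  calc Real.pi⁻¹ * ‖∫ w, w⁻¹ * ψ (z - w)‖ ≤ 1 * (2 * A * δ ^ a *
      (I1 + 8 * A * δ ^ (-(a / 2)) * I2)) := by gcongr
    _ = 2 * A * δ ^ (a / 2) * (δ ^ (a / 2) * I1 + 8 * A * (δ ^ (a / 2) * δ ^ (-(a / 2))) * I2) := by
        rw [hδa]; ring
    _ ≤ 2 * A * δ ^ (a / 2) * (1 * I1 + 8 * A * 1 * I2) := by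
        rw [hδ2]; gcongr
    _ = _ := by ring

/-- If `G^(j+1)` is close to `H^j` on the unit disc, the regularised quotient of `H` by `G` is
close to a holomorphic function. -/
lemma exists_holomorphic_near_regQuot {j : ℕ} (hj : 1 ≤ j) {A : ℝ} (hA : 1 ≤ A) :
    ∃ C : ℝ, 1 ≤ C ∧ ∀ δ : ℝ, 0 < δ → δ ≤ 1 → ∀ G H : ℂ → ℂ, Differentiable ℂ G →
      Differentiable ℂ H → (∀ z ∈ ball (0 : ℂ) 1, ‖G z‖ ≤ A) →
      (∀ z ∈ ball (0 : ℂ) 1, ‖G z ^ (j + 1) - H z ^ j‖ ≤ A * δ ^ (j + 1)) →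
      ∃ F : ℂ → ℂ, DifferentiableOn ℂ F (ball 0 (1 / 2)) ∧
        ∀ z ∈ ball (0 : ℂ) (1 / 2),
          ‖F z - regQuot G H δ z‖ ≤ C * δ ^ ((1 : ℝ) / (4 * j)) ∧ ‖F z‖ ≤ C := by
  have hj0 : (1 : ℝ) ≤ j := by exact_mod_cast hj
  set a : ℝ := 1 / (2 * j) with ha
  have ha0 : 0 < a := by positivity
  have ha1 : a ≤ 1 := by rw [ha, div_le_one (by positivity)]; linarith
  set C0 := 2 * A * ((∫ z, 2 * A ^ 2 / a * ‖dbar (fun z => (cutoff z : ℂ)) z‖ ^ 2) +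
      8 * A * ∫ w in ball (0 : ℂ) 2, ‖w‖ ^ (-2 + a / 2)) with hC0
  have hC0' : 0 ≤ C0 := by
    have h1 : 0 ≤ ∫ z, 2 * A ^ 2 / a * ‖dbar (fun z => (cutoff z : ℂ)) z‖ ^ 2 :=
      integral_nonneg fun w => by positivity
    have h2 : 0 ≤ ∫ w in ball (0 : ℂ) 2, ‖w‖ ^ (-2 + a / 2) := integral_nonneg fun w => by positivity
    positivity
  refine ⟨C0 + 2 * A * (2 * A ^ 2), by nlinarith [mul_nonneg (sub_nonneg.2 hA) (sq_nonneg A)], ?_⟩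
  intro δ hδ hδ1 G H hG hH hGA hGH
  have hHb : ∀ z ∈ ball (0 : ℂ) 1, ‖H z‖ ≤ 2 * A * regSq G δ z ^ ((1 : ℝ) / 2 + a) := fun z hz =>
    norm_le_regSq_rpow hj hA hδ (hGH z hz)
  set ψ : ℂ → ℂ := fun z => (cutoff z : ℂ) * (H z * (starRingEnd ℂ) (deriv G z) *
    ((δ : ℂ) ^ 2 * ((regSq G δ z ^ (-2 : ℝ) : ℝ) : ℂ))) with hψ
  have hG'd : Differentiable ℂ (deriv G) := (hG.contDiff (n := 2)).differentiable_deriv_two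
  have hψd : ContDiff ℝ 1 ψ := (contDiff_cutoff.mul (((hH.contDiff.restrict_scalars ℝ).mul
    (contDiff_conj_comp hG'd)).mul (contDiff_const.mul (contDiff_regSq_rpow hG hδ _)))).of_le
      (by norm_num)
  have hψc : HasCompactSupport ψ :=
    hasCompactSupport_of_eq_zero (R := 3 / 4) fun z hz => by simp [hψ, cutoff_eq_zero hz.le]
  have hψb : ∀ z, ‖ψ z‖ ≤ 2 * A * δ ^ a * energyDensity G δ a z := by
    intro z
    rcases le_or_gt (3 / 4) ‖z‖ with hz | hz
    · rw [energyDensity_eq_zero hz]; simp [hψ, cutoff_eq_zero hz]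
    have hS := regSq_pos (G := G) hδ z
    have hH1 := hHb z (by rw [mem_ball_zero_iff]; linarith)
    have hSδ := sq_le_regSq (G := G) (δ := δ) z
    simp only [hψ, norm_mul, norm_pow, Complex.norm_real, RCLike.norm_conj, energyDensity]
    rw [Real.norm_of_nonneg (cutoff.nonneg' z), Real.norm_of_nonneg hδ.le]
    set S := regSq G δ z
    rw [Real.norm_of_nonneg (by positivity)]
    have hc : 0 ≤ cutoff z := cutoff.nonneg' z
    have h1 : S ^ ((1 : ℝ) / 2 + a) * S ^ (-2 : ℝ) = S ^ (a / 2 - 1) * S ^ (a / 2 - 1 / 2) := by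
      rw [← Real.rpow_add hS, ← Real.rpow_add hS]; congr 1; ring
    have h2 : δ * S ^ (a / 2 - 1 / 2) ≤ δ ^ a := by
      calc δ * S ^ (a / 2 - 1 / 2) ≤ δ * (δ ^ 2) ^ (a / 2 - 1 / 2) := by
            gcongr ?_ * ?_
            exact Real.rpow_le_rpow_of_nonpos (by positivity) hSδ (by linarith)
        _ = δ ^ (1 : ℝ) * δ ^ (a - 1) := by
            rw [Real.rpow_one, ← Real.rpow_natCast, ← Real.rpow_mul hδ.le]
            congr 2; push_cast; ring
        _ = δ ^ a := by rw [← Real.rpow_add hδ]; congr 1; ring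
    calc cutoff z * (‖H z‖ * ‖deriv G z‖ * (δ ^ 2 * S ^ (-2 : ℝ))) ≤
        cutoff z * (2 * A * S ^ ((1 : ℝ) / 2 + a) * ‖deriv G z‖ * (δ ^ 2 * S ^ (-2 : ℝ))) := by
          gcongr
      _ = 2 * A * (cutoff z * ‖deriv G z‖ * δ ^ 2 * (S ^ ((1 : ℝ) / 2 + a) * S ^ (-2 : ℝ))) := by
          ring
      _ = 2 * A * (δ * S ^ (a / 2 - 1 / 2)) * (cutoff z * ‖deriv G z‖ * δ * S ^ (a / 2 - 1)) := by
          rw [h1]; ring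
      _ ≤ _ := by gcongr
  set u := cauchyTransform ψ with hu
  have hball : ∀ z ∈ ball (0 : ℂ) (1 / 2), z ∈ ball (0 : ℂ) 1 := fun z hz =>
    ball_subset_ball (by norm_num) hz
  have hub : ∀ z ∈ ball (0 : ℂ) 1, ‖u z‖ ≤ C0 * δ ^ (a / 2) := fun z hz =>
    norm_cauchyTransform_le ha0 ha1 hA hδ hδ1 hG hGA hψb (by simpa using hz)
  have hexp : a / 2 = 1 / (4 * j) := by rw [ha]; field_simp; norm_num
  refine ⟨fun z => regQuot G H δ z - u z, fun z hz => ?_, fun z hz => ⟨?_, ?_⟩⟩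
  · have hφ := differentiableAt_regQuot hG hH hδ z
    have hud := hasFDerivAt_cauchyTransform hψd hψc z
    refine (differentiableAt_of_dbar_eq_zero (hφ.fun_sub hud.1) ?_).differentiableWithinAt
    rw [dbar_sub hφ hud.1, hud.2, dbar_regQuot hG hH hδ]
    simp only [hψ]
    rw [cutoff_eq_one (by rw [mem_ball_zero_iff] at hz; exact hz.le)]
    push_cast
    ring
  · have : regQuot G H δ z - u z - regQuot G H δ z = -u z := by ring
    rw [this, norm_neg, ← hexp]
    refine (hub z (hball z hz)).trans ?_
    gcongr
    nlinarith [mul_nonneg (zero_le_one.trans hA) (sq_nonneg A)]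
  · have h1 := hub z (hball z hz)
    have h2 : ‖regQuot G H δ z‖ ≤ 2 * A * regSq G δ z ^ a := norm_regQuot_le hδ (hHb z (hball z hz))
    have h3 : regSq G δ z ^ a ≤ 2 * A ^ 2 := by
      have hS3 : regSq G δ z ≤ 2 * A ^ 2 := by
        have h4 := hGA z (hball z hz)
        have h5 : ‖G z‖ ^ 2 ≤ A ^ 2 := by gcongr
        have h6 : δ ^ 2 ≤ 1 := by nlinarith
        rw [regSq]; nlinarith
      have := regSq_pos (G := G) hδ z
      calc regSq G δ z ^ a ≤ (2 * A ^ 2) ^ a := by gcongr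
        _ ≤ (2 * A ^ 2) ^ (1 : ℝ) := Real.rpow_le_rpow_of_exponent_le (by nlinarith) ha1
        _ = _ := Real.rpow_one _
    have h4 : δ ^ (a / 2) ≤ 1 := Real.rpow_le_one hδ.le hδ1 (by linarith)
    calc ‖regQuot G H δ z - u z‖ ≤ ‖regQuot G H δ z‖ + ‖u z‖ := norm_sub_le _ _
      _ ≤ 2 * A * (2 * A ^ 2) + C0 * 1 := by
        gcongr
        · exact h2.trans (by gcongr)
        · exact h1.trans (by gcongr)
      _ = _ := by ring

end Integrals

/-- The properties of `m = lc M` that enter the proof. -/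
structure AdmissibleSeq (m : ℕ → ℝ) : Prop where
  pos : ∀ k, 0 < m k
  root : RootsTendsto m
  zero : m 0 = 1
  gamma : ∃ C : ℝ, 1 ≤ C ∧ ∀ t : ℝ, 0 < t → GammaUpper m (C * t) ≤ GammaLower m t
  growth : ∃ ρ : ℝ, 1 ≤ ρ ∧ ∀ j k, m (j + k) ≤ ρ ^ (j + k) * (m j * m k)

/-- `g` has Taylor expansions at `0` of every order, with coefficients and remainders on `(-R, R)`
controlled by the sequence `m`. -/
def JetBound (m : ℕ → ℝ) (A ρ R : ℝ) (g : ℝ → ℂ) : Prop :=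
  ∃ c : ℕ → ℂ, (∀ k, ‖c k‖ ≤ A * ρ ^ k * m k) ∧ ∀ N : ℕ, ∀ y : ℝ, |y| < R →
    ‖g y - ∑ k ∈ Finset.range N, c k * (y : ℂ) ^ k‖ ≤ A * ρ ^ N * m N * |y| ^ N

lemma norm_pow_sub_pow_le {a b : ℂ} {B : ℝ} (hB : 1 ≤ B) (ha : ‖a‖ ≤ B) (hb : ‖b‖ ≤ B) (n : ℕ) :
    ‖a ^ n - b ^ n‖ ≤ n * B ^ n * ‖a - b‖ := by
  induction n with
  | zero => simp
  | succ n ih =>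
    have hB0 : 0 ≤ B := zero_le_one.trans hB
    have h1 : a ^ (n + 1) - b ^ (n + 1) = a * (a ^ n - b ^ n) + b ^ n * (a - b) := by ring
    calc ‖a ^ (n + 1) - b ^ (n + 1)‖ ≤ ‖a‖ * ‖a ^ n - b ^ n‖ + ‖b‖ ^ n * ‖a - b‖ := by
          rw [h1, ← norm_mul, ← norm_pow, ← norm_mul]; exact norm_add_le _ _
      _ ≤ B * (n * B ^ n * ‖a - b‖) + B ^ n * B * ‖a - b‖ := by
          gcongr
          calc ‖b‖ ^ n ≤ B ^ n := by gcongr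
            _ ≤ B ^ n * B := le_mul_of_one_le_right (by positivity) hB
      _ = ((n + 1 : ℕ) : ℝ) * B ^ (n + 1) * ‖a - b‖ := by push_cast; ring

lemma norm_regQuot_sub_le {j : ℕ} (hj : 1 ≤ j) {A δ : ℝ} (hA : 1 ≤ A) (hδ : 0 < δ) (hδ1 : δ ≤ 1)
    {G H : ℂ → ℂ} {f z : ℂ} (hf : ‖f‖ ≤ A) (hG : ‖f ^ j - G z‖ ≤ A * δ ^ 2)
    (hH : ‖f ^ (j + 1) - H z‖ ≤ A * δ ^ 2) :
    ‖regQuot G H δ z - f‖ ≤ (1 + A) ^ 2 * δ ^ ((1 : ℝ) / (4 * j)) := by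
  have hS := regSq_pos (G := G) hδ z
  have hj0 : (1 : ℝ) ≤ j := by exact_mod_cast hj
  have hg : ‖G z‖ ≤ √(regSq G δ z) := Real.le_sqrt_of_sq_le (norm_sq_le_regSq z)
  have hd : δ ≤ √(regSq G δ z) := Real.le_sqrt_of_sq_le (sq_le_regSq z)
  have hSδ := sq_le_regSq (G := G) (δ := δ) z
  have hSeq : (regSq G δ z : ℂ) = G z * (starRingEnd ℂ) (G z) + (δ : ℂ) ^ 2 := by
    rw [Complex.mul_conj', regSq]; push_cast; ring
  rw [regQuot, Real.rpow_neg_one, Complex.ofReal_inv]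
  set S := regSq G δ z with hSdef
  have hS0 : (S : ℂ) ≠ 0 := by exact_mod_cast hS.ne'
  have hfS : ‖f‖ ≤ (1 + A) * S ^ ((1 : ℝ) / (2 * j)) := by
    have h1 : ‖f‖ ^ j ≤ (1 + A) * √S := by
      have h2 : ‖f ^ j‖ ≤ ‖G z‖ + ‖f ^ j - G z‖ := norm_le_insert' _ _
      rw [norm_pow] at h2
      have h3 : δ ^ 2 ≤ √S := by nlinarith
      nlinarith
    refine le_of_pow_le_pow_left₀ (by omega : j ≠ 0) (by positivity) (h1.trans ?_)
    have h6 : √S = (S ^ ((1 : ℝ) / (2 * j))) ^ j := by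
      rw [Real.sqrt_eq_rpow, ← Real.rpow_natCast, ← Real.rpow_mul hS.le]
      congr 1
      field_simp
    rw [mul_pow, ← h6]
    gcongr
    exact le_self_pow₀ (by linarith) (by omega)
  have hid : H z * ((starRingEnd ℂ) (G z) * (S : ℂ)⁻¹) - f =
      ((starRingEnd ℂ) (G z) * ((H z - f ^ (j + 1)) + f * (f ^ j - G z)) - f * (δ : ℂ) ^ 2) /
        (S : ℂ) := by
    rw [eq_div_iff hS0, sub_mul, mul_assoc, mul_assoc, inv_mul_cancel₀ hS0, hSeq]
    ring
  have hnum : ‖(starRingEnd ℂ) (G z) * ((H z - f ^ (j + 1)) + f * (f ^ j - G z)) -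
      f * (δ : ℂ) ^ 2‖ ≤ √S * (A * δ ^ 2 + A * (A * δ ^ 2)) +
        (1 + A) * S ^ ((1 : ℝ) / (2 * j)) * δ ^ 2 := by
    refine (norm_sub_le _ _).trans ?_
    rw [norm_mul, norm_mul, norm_pow, Complex.norm_real, Real.norm_of_nonneg hδ.le, RCLike.norm_conj]
    gcongr
    refine (norm_add_le _ _).trans ?_
    rw [norm_mul, norm_sub_rev]
    gcongr
  have hle : ∀ p : ℝ, 1 / (4 * j) ≤ p → δ ^ p ≤ δ ^ ((1 : ℝ) / (4 * j)) := fun p hp =>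
    Real.rpow_le_rpow_of_exponent_ge hδ hδ1 hp
  have h1 : √S * δ ^ 2 / S ≤ δ ^ ((1 : ℝ) / (4 * j)) := by
    have h2 : √S * δ ^ 2 / S ≤ δ := by
      rw [div_le_iff₀ hS]
      have := Real.mul_self_sqrt hS.le
      nlinarith [mul_nonneg (mul_nonneg hδ.le (sub_nonneg.2 hd)) (Real.sqrt_nonneg S)]
    refine h2.trans ?_
    have := hle 1 (by rw [div_le_one (by positivity)]; linarith)
    rwa [Real.rpow_one] at this
  have h2 : S ^ ((1 : ℝ) / (2 * j)) * δ ^ 2 / S ≤ δ ^ ((1 : ℝ) / (4 * j)) := by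
    have h3 : S ^ ((1 : ℝ) / (2 * j)) / S ≤ δ ^ ((1 : ℝ) / j - 2) := by
      rw [← Real.rpow_sub_one hS.ne']
      calc S ^ ((1 : ℝ) / (2 * j) - 1) ≤ (δ ^ 2) ^ ((1 : ℝ) / (2 * j) - 1) := by
            refine Real.rpow_le_rpow_of_nonpos (by positivity) hSδ ?_
            rw [sub_nonpos, div_le_one (by positivity)]; linarith
        _ = δ ^ ((1 : ℝ) / j - 2) := by
            rw [← Real.rpow_natCast, ← Real.rpow_mul hδ.le]
            congr 1
            push_cast
            field_simp
    calc S ^ ((1 : ℝ) / (2 * j)) * δ ^ 2 / S = S ^ ((1 : ℝ) / (2 * j)) / S * δ ^ 2 := by ring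
      _ ≤ δ ^ ((1 : ℝ) / j - 2) * δ ^ 2 := by gcongr
      _ = δ ^ ((1 : ℝ) / j) := by
          rw [← Real.rpow_natCast, ← Real.rpow_add hδ]; congr 1; push_cast; ring
      _ ≤ _ := hle _ (by gcongr; linarith)
  rw [hid, norm_div, Complex.norm_real, Real.norm_of_nonneg hS.le]
  calc _ ≤ (√S * (A * δ ^ 2 + A * (A * δ ^ 2)) +
        (1 + A) * S ^ ((1 : ℝ) / (2 * j)) * δ ^ 2) / S := by gcongr
    _ = (A + A ^ 2) * (√S * δ ^ 2 / S) + (1 + A) * (S ^ ((1 : ℝ) / (2 * j)) * δ ^ 2 / S) := by ring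
    _ ≤ (A + A ^ 2) * δ ^ ((1 : ℝ) / (4 * j)) + (1 + A) * δ ^ ((1 : ℝ) / (4 * j)) := by gcongr
    _ = _ := by ring

lemma norm_sum_coeff_mul_pow_le {m : ℕ → ℝ} {A ρ r : ℝ} (hA : 0 ≤ A) {c : ℕ → ℂ} {N : ℕ}
    (hρ : 0 < ρ) (hc : ∀ k, ‖c k‖ ≤ A * ρ ^ k * m k) (hN : ∀ k ≤ N, m k * (2 * ρ * r) ^ k ≤ 1)
    {z : ℂ} (hz : ‖z‖ ≤ r) : ‖∑ k ∈ Finset.range N, c k * z ^ k‖ ≤ 2 * A := by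
  have hr : 0 ≤ r := (norm_nonneg z).trans hz
  calc ‖∑ k ∈ Finset.range N, c k * z ^ k‖ ≤ ∑ k ∈ Finset.range N, A * (1 / 2) ^ k := by
        refine norm_sum_le_of_le _ fun k hk => ?_
        rw [norm_mul, norm_pow]
        calc ‖c k‖ * ‖z‖ ^ k ≤ A * ρ ^ k * m k * r ^ k := by
                have := (norm_nonneg _).trans (hc k)
                gcongr
                exact hc k
          _ = A * (1 / 2) ^ k * (m k * (2 * ρ * r) ^ k) := by
            rw [mul_pow, mul_pow, div_pow, one_pow]; field_simp
          _ ≤ A * (1 / 2) ^ k * 1 := by gcongr; exact hN k (Finset.mem_range.1 hk).le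
          _ = _ := mul_one _
    _ = A * ∑ k ∈ Finset.range N, (1 / 2 : ℝ) ^ k := by rw [Finset.mul_sum]
    _ ≤ A * 2 := by gcongr; exact sum_geometric_two_le N
    _ = _ := mul_comm _ _

lemma AdmissibleSeq.hfn_le_one {m : ℕ → ℝ} (hm : AdmissibleSeq m) {t : ℝ} (ht : 0 < t) :
    hfn m t ≤ 1 := by
  simpa [hm.zero] using hfn_le hm.pos ht 0

/-- Near `0`, a function both of whose powers `φ^j`, `φ^(j+1)` have controlled jets is very close
to a bounded holomorphic function. -/
lemma exists_local_holomorphic {m : ℕ → ℝ} (hm : AdmissibleSeq m) {j : ℕ} (hj : 1 ≤ j) {A ρ : ℝ}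
    (hA : 1 ≤ A) (hρ : 0 < ρ) : ∃ C B : ℝ, 1 ≤ C ∧ 0 < B ∧ ∀ (R : ℝ) (φ : ℝ → ℂ),
      JetBound m A ρ R (fun y => φ y ^ j) → JetBound m A ρ R (fun y => φ y ^ (j + 1)) →
      ∀ r, 0 < r → r < R → ∃ F : ℂ → ℂ, DifferentiableOn ℂ F (ball 0 (r / 8)) ∧
        (∀ z ∈ ball (0 : ℂ) (r / 8), ‖F z‖ ≤ C) ∧
        ∀ y : ℝ, |y| < r / 8 → ‖F y - φ y‖ ≤ C * hfn m (B * r) ^ 2 := by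
  obtain ⟨C₀, hC₀, hΓ⟩ := hm.gamma
  obtain ⟨ρ₀, hρ₀, hgr⟩ := hm.growth
  obtain ⟨B₀, hB₀, hB⟩ := exists_hfn_le_pow hm.pos hm.root hm.zero hρ₀ hgr (16 * j * (j + 1))
  set A₁ : ℝ := 2 * (j + 1) * (2 * A) ^ (j + 2) with hA₁
  have hj0 : (1 : ℝ) ≤ j := by exact_mod_cast hj
  have h2A : 1 ≤ 2 * A := by linarith
  have hA₁A : 2 * A ≤ A₁ := by
    calc 2 * A ≤ (2 * A) ^ (j + 2) := le_self_pow₀ h2A (by omega)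
      _ ≤ 2 * (j + 1) * (2 * A) ^ (j + 2) := le_mul_of_one_le_left (by positivity) (by linarith)
  obtain ⟨C₁, hC₁, hcore⟩ := exists_holomorphic_near_regQuot hj (A := A₁) (by linarith)
  refine ⟨C₁ + (1 + A) ^ 2, B₀ * (2 * C₀ * ρ), by nlinarith, by positivity, ?_⟩
  intro R φ hg hh r hr hrR
  obtain ⟨c, hc, hcR⟩ := hg
  obtain ⟨e, he, heR⟩ := hh
  obtain ⟨N, hN, hNk⟩ := exists_index hm.pos hm.root hC₀ (t := 2 * ρ * r) (by positivity)
    (hΓ _ (by positivity))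
  rw [hm.zero] at hNk
  set η := hfn m (C₀ * (2 * ρ * r)) with hη
  have hη0 : 0 < η := hfn_pos hm.pos hm.root (by positivity)
  have hη1 : η ≤ 1 := hm.hfn_le_one (by positivity)
  set κ := hfn m (B₀ * (2 * C₀ * ρ) * r) with hκ
  have hκ0 : 0 < κ := hfn_pos hm.pos hm.root (by positivity)
  have hκ1 : κ ≤ 1 := hm.hfn_le_one (by positivity)
  have hηκ : η ≤ κ ^ (16 * j * (j + 1)) := by
    have := hB (C₀ * (2 * ρ * r)) (by positivity)
    rwa [show B₀ * (C₀ * (2 * ρ * r)) = B₀ * (2 * C₀ * ρ) * r by ring] at this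
  set G : ℂ → ℂ := fun z => ∑ k ∈ Finset.range N, c k * z ^ k with hGdef
  set H : ℂ → ℂ := fun z => ∑ k ∈ Finset.range N, e k * z ^ k with hHdef
  have hGd : Differentiable ℂ G := by fun_prop
  have hHd : Differentiable ℂ H := by fun_prop
  have hG2 : ∀ z : ℂ, ‖z‖ ≤ r → ‖G z‖ ≤ 2 * A := fun z hz =>
    norm_sum_coeff_mul_pow_le (by linarith) hρ hc hNk hz
  have hH2 : ∀ z : ℂ, ‖z‖ ≤ r → ‖H z‖ ≤ 2 * A := fun z hz =>
    norm_sum_coeff_mul_pow_le (by linarith) hρ he hNk hz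
  have hrem : ∀ y : ℝ, |y| < r → A * ρ ^ N * m N * |y| ^ N ≤ A * η := by
    intro y hy
    have := hm.pos N
    calc A * ρ ^ N * m N * |y| ^ N = A * (m N * (ρ * |y|) ^ N) := by rw [mul_pow]; ring
      _ ≤ A * (m N * (C₀ * (2 * ρ * r)) ^ N) := by
        have h1 : ρ * |y| ≤ C₀ * (2 * ρ * r) := by
          nlinarith [mul_nonneg hρ.le hr.le, mul_le_mul_of_nonneg_left hy.le hρ.le]
        gcongr ?_ * (?_ * ?_ ^ N)
      _ = A * η := by rw [hN]
  have hGr : ∀ y : ℝ, |y| < r → ‖φ y ^ j - G y‖ ≤ A * η := fun y hy =>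
    (hcR N y (hy.trans hrR)).trans (hrem y hy)
  have hHr : ∀ y : ℝ, |y| < r → ‖φ y ^ (j + 1) - H y‖ ≤ A * η := fun y hy =>
    (heR N y (hy.trans hrR)).trans (hrem y hy)
  have hgA : ∀ y : ℝ, |y| < r → ‖φ y ^ j‖ ≤ A := fun y hy => by
    simpa [hm.zero] using hcR 0 y (hy.trans hrR)
  have hhA : ∀ y : ℝ, |y| < r → ‖φ y ^ (j + 1)‖ ≤ A := fun y hy => by
    simpa [hm.zero] using heR 0 y (hy.trans hrR)
  have hφA : ∀ y : ℝ, |y| < r → ‖φ y‖ ≤ A := fun y hy => by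
    refine le_of_pow_le_pow_left₀ (by omega : j ≠ 0) (by linarith) ?_
    rw [← norm_pow]
    exact (hgA y hy).trans (le_self_pow₀ hA (by omega))
  set P : ℂ → ℂ := fun z => G z ^ (j + 1) - H z ^ j with hP
  have hPA : ∀ z ∈ ball (0 : ℂ) r, ‖P z‖ ≤ A₁ := by
    intro z hz
    rw [mem_ball_zero_iff] at hz
    calc ‖P z‖ ≤ ‖G z‖ ^ (j + 1) + ‖H z‖ ^ j := by
          rw [← norm_pow, ← norm_pow]; exact norm_sub_le _ _
      _ ≤ (2 * A) ^ (j + 1) + (2 * A) ^ j := by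
          gcongr
          · exact hG2 z hz.le
          · exact hH2 z hz.le
      _ ≤ (2 * A) ^ (j + 2) + (2 * A) ^ (j + 2) := by
          gcongr <;> first | exact h2A | omega
      _ ≤ A₁ := by rw [hA₁]; nlinarith [pow_pos (by linarith : 0 < 2 * A) (j + 2)]
  have hPη : ∀ y : ℝ, |y| < r → ‖P y‖ ≤ A₁ * η := by
    intro y hy
    have hy' : ‖(y : ℂ)‖ ≤ r := by rw [Complex.norm_real]; exact hy.le
    have h1 : P y = (G y ^ (j + 1) - (φ y ^ j) ^ (j + 1)) +
        ((φ y ^ (j + 1)) ^ j - H y ^ j) := by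
      simp only [hP]; ring
    have h2 := norm_pow_sub_pow_le h2A (hG2 y hy') ((hgA y hy).trans (by linarith)) (j + 1)
    have h3 := norm_pow_sub_pow_le h2A ((hhA y hy).trans (by linarith)) (hH2 y hy') j
    rw [norm_sub_rev (G y)] at h2
    calc ‖P y‖ ≤ ((j + 1 : ℕ) : ℝ) * (2 * A) ^ (j + 1) * (A * η) + j * (2 * A) ^ j * (A * η) := by
          rw [h1]
          refine (norm_add_le _ _).trans (add_le_add (h2.trans ?_) (h3.trans ?_))
          · gcongr; exact hGr y hy
          · gcongr; exact hHr y hy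
      _ ≤ (j + 1) * (2 * A) ^ (j + 1) * (2 * A * η) + (j + 1) * (2 * A) ^ (j + 1) * (2 * A * η) := by
          push_cast
          gcongr <;> first | exact h2A | linarith
      _ = A₁ * η := by rw [hA₁]; ring
  have hPd : DifferentiableOn ℂ P (ball 0 r) := by fun_prop
  have hhad := norm_sq_le_of_real_diameter hr hPd hPA (by positivity)
    (mul_le_of_le_one_right (by linarith) hη1) hPη
  set δ := κ ^ (8 * j) with hδ
  have hδ0 : 0 < δ := by positivity
  have hδ1 : δ ≤ 1 := pow_le_one₀ hκ0.le hκ1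
  have hδp : (δ ^ (j + 1)) ^ 2 = κ ^ (16 * j * (j + 1)) := by
    rw [hδ, ← pow_mul, ← pow_mul]; congr 1; ring
  have hPδ : ∀ z ∈ ball (0 : ℂ) (r / 4), ‖P z‖ ≤ A₁ * δ ^ (j + 1) := by
    intro z hz
    refine le_of_pow_le_pow_left₀ two_ne_zero (by positivity) ((hhad z hz).trans ?_)
    rw [mul_pow, hδp]
    have : A₁ * (A₁ * η) ≤ A₁ * (A₁ * κ ^ (16 * j * (j + 1))) := by gcongr
    linarith
  have hηδ : η ≤ δ ^ 2 := by
    refine hηκ.trans ?_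
    rw [hδ, ← pow_mul]
    refine pow_le_pow_of_le_one hκ0.le hκ1 ?_
    nlinarith
  have hscale : ∀ z ∈ ball (0 : ℂ) 1, ((r / 4 : ℝ) : ℂ) * z ∈ ball (0 : ℂ) (r / 4) := by
    intro z hz
    rw [mem_ball_zero_iff] at hz ⊢
    rw [norm_mul, Complex.norm_real, Real.norm_of_nonneg (by positivity)]
    nlinarith
  obtain ⟨F, hFd, hF⟩ := hcore δ hδ0 hδ1 (fun z => G (((r / 4 : ℝ) : ℂ) * z))
    (fun z => H (((r / 4 : ℝ) : ℂ) * z)) (hGd.comp (by fun_prop)) (hHd.comp (by fun_prop))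
    (fun z hz => by
      have := hscale z hz
      rw [mem_ball_zero_iff] at this
      exact (hG2 _ (by linarith)).trans hA₁A)
    (fun z hz => hPδ _ (hscale z hz))
  have hunscale : ∀ z ∈ ball (0 : ℂ) (r / 8), ((4 / r : ℝ) : ℂ) * z ∈ ball (0 : ℂ) (1 / 2) := by
    intro z hz
    rw [mem_ball_zero_iff] at hz ⊢
    rw [norm_mul, Complex.norm_real, Real.norm_of_nonneg (by positivity), div_mul_eq_mul_div,
      div_lt_iff₀ hr]
    linarith
  refine ⟨fun z => F (((4 / r : ℝ) : ℂ) * z), ?_, ?_, ?_⟩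
  · exact hFd.comp (by fun_prop) hunscale
  · intro z hz
    exact ((hF _ (hunscale z hz)).2).trans (by nlinarith)
  · intro y hy
    have hy' : (y : ℂ) ∈ ball (0 : ℂ) (r / 8) := by
      rw [mem_ball_zero_iff, Complex.norm_real]; exact hy
    have hyr : |y| < r := by linarith
    have h1 := (hF _ (hunscale _ hy')).1
    have hcancel : ((r / 4 : ℝ) : ℂ) * (((4 / r : ℝ) : ℂ) * y) = y := by
      rw [← mul_assoc, ← Complex.ofReal_mul]
      have : r / 4 * (4 / r) = 1 := by field_simp
      rw [this]; simp
    have h2 := norm_regQuot_sub_le hj hA hδ0 hδ1 (G := fun z => G (((r / 4 : ℝ) : ℂ) * z))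
      (H := fun z => H (((r / 4 : ℝ) : ℂ) * z)) (z := ((4 / r : ℝ) : ℂ) * y) (hφA y hyr)
      (by simp only [hcancel]; exact (hGr y hyr).trans (by gcongr))
      (by simp only [hcancel]; exact (hHr y hyr).trans (by gcongr))
    have hpow : δ ^ ((1 : ℝ) / (4 * j)) = κ ^ 2 := by
      rw [hδ, ← Real.rpow_natCast, ← Real.rpow_natCast, ← Real.rpow_mul hκ0.le]
      congr 1
      push_cast
      field_simp
      norm_num
    rw [hpow] at h1 h2
    calc _ ≤ C₁ * κ ^ 2 + (1 + A) ^ 2 * κ ^ 2 :=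
          (norm_sub_le_norm_sub_add_norm_sub _ _ _).trans (add_le_add h1 h2)
      _ = _ := by ring

lemma exists_polynomial_near {F : ℂ → ℂ} {A R : ℝ} (hR : 0 < R)
    (hF : DifferentiableOn ℂ F (ball 0 R)) (hA : ∀ z ∈ ball (0 : ℂ) R, ‖F z‖ ≤ A) (k : ℕ) :
    ∃ P : Polynomial ℂ, P.degree < k ∧
      ∀ z ∈ ball (0 : ℂ) R, ‖F z - P.eval z‖ ≤ A * (2 * ‖z‖ / R) ^ k := by
  induction k generalizing F A with
  | zero => exact ⟨0, by simp, fun z hz => by simpa using hA z hz⟩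
  | succ k ih =>
    have h0 : (0 : ℂ) ∈ ball (0 : ℂ) R := mem_ball_self hR
    have hmaps : MapsTo F (ball 0 R) (closedBall (F 0) (2 * A)) := fun z hz => by
      rw [mem_closedBall, dist_eq_norm]
      exact (norm_sub_le _ _).trans (by linarith [hA z hz, hA 0 h0])
    obtain ⟨P, hPd, hP⟩ := ih (F := dslope F 0) (A := 2 * A / R)
      ((Complex.differentiableOn_dslope (ball_mem_nhds _ hR)).2 hF)
      (fun z hz => Complex.norm_dslope_le_div_of_mapsTo_ball hF hmaps hz)
    refine ⟨Polynomial.X * P + Polynomial.C (F 0), ?_, fun z hz => ?_⟩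
    · have hk : P.natDegree < k ∨ P = 0 := by
        rcases eq_or_ne P 0 with h | h
        · exact Or.inr h
        · exact Or.inl ((Polynomial.natDegree_lt_iff_degree_lt h).2 hPd)
      have hdeg : (Polynomial.X * P + Polynomial.C (F 0)).natDegree < k + 1 := by
        refine (Polynomial.natDegree_add_C).trans_lt ?_
        rcases hk with hk | rfl
        · exact (Polynomial.natDegree_mul_le.trans (by rw [Polynomial.natDegree_X])).trans_lt
            (by omega)
        · simp
      refine Polynomial.degree_le_natDegree.trans_lt ?_
      exact_mod_cast hdeg
    · have hsub : F z - (Polynomial.X * P + Polynomial.C (F 0)).eval z =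
          z * (dslope F 0 z - P.eval z) := by
        have := sub_smul_dslope F 0 z
        simp only [sub_zero, smul_eq_mul] at this
        simp only [Polynomial.eval_add, Polynomial.eval_mul, Polynomial.eval_X, Polynomial.eval_C]
        linear_combination -this
      rw [hsub, norm_mul]
      calc ‖z‖ * ‖dslope F 0 z - P.eval z‖ ≤ ‖z‖ * (2 * A / R * (2 * ‖z‖ / R) ^ k) := by
            gcongr; exact hP z hz
        _ = A * (2 * ‖z‖ / R) ^ (k + 1) := by ring

lemma AdmissibleSeq.hfn_mono {m : ℕ → ℝ} (hm : AdmissibleSeq m) {s t : ℝ} (hs : 0 < s)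
    (hst : s ≤ t) : hfn m s ≤ hfn m t := by
  obtain ⟨k, hk⟩ := exists_hfn_eq hm.pos hm.root (hs.trans_le hst)
  rw [hk]
  have := hm.pos k
  exact (hfn_le hm.pos hs k).trans (by gcongr)

/-- A function both of whose powers `φ^j`, `φ^(j+1)` have controlled jets is close to polynomials
at every scale. -/
lemma exists_polynomial_approx {m : ℕ → ℝ} (hm : AdmissibleSeq m) {j : ℕ} (hj : 1 ≤ j) {A ρ R : ℝ}
    (hA : 1 ≤ A) (hρ : 0 < ρ) (hR : 0 < R) : ∃ C ρ' τ₀ : ℝ, 0 < C ∧ 0 < ρ' ∧ 0 < τ₀ ∧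
      ∀ φ : ℝ → ℂ, JetBound m A ρ R (fun y => φ y ^ j) → JetBound m A ρ R (fun y => φ y ^ (j + 1)) →
      ∀ k : ℕ, ∀ τ, 0 < τ → τ ≤ τ₀ → ∃ P : Polynomial ℂ, P.degree < k ∧
        ∀ y : ℝ, |y| ≤ τ → ‖φ y - P.eval (y : ℂ)‖ ≤ C * ρ' ^ k * m k * τ ^ k := by
  obtain ⟨C, B, hC, hB, hloc⟩ := exists_local_holomorphic hm hj hA hρ
  obtain ⟨ρ₀, hρ₀, hgr⟩ := hm.growth
  have hh1 : 0 < hfn m 1 := hfn_pos hm.pos hm.root one_pos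
  have hm1 := hm.pos 1
  set r₀ := R / 2 with hr₀
  have hr₀0 : 0 < r₀ := by positivity
  refine ⟨C + C / hfn m 1 + 4 * C * r₀ * B * ρ₀ * m 1, 256 * B + 16 / r₀ + 128 * B * ρ₀, r₀ / 128,
    by positivity, by positivity, by positivity, ?_⟩
  intro φ hg hh k τ hτ hτ₀
  have hmk := hm.pos k
  set r : ℕ → ℝ := fun n => r₀ * (1 / 2) ^ n with hr
  have hr0 : ∀ n, 0 < r n := fun n => by positivity
  have hrs : ∀ n, r (n + 1) = r n / 2 := fun n => by simp only [hr]; ring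
  have hrR : ∀ n, r n < R := fun n => by
    have : r n ≤ r₀ := mul_le_of_le_one_right hr₀0.le (pow_le_one₀ (by norm_num) (by norm_num))
    linarith
  choose F hFd hFC hFφ using fun n => hloc R φ hg hh (r n) (hr0 n) (hrR n)
  set κ : ℕ → ℝ := fun n => hfn m (B * r n) with hκ
  have hκ0 : ∀ n, 0 < κ n := fun n => hfn_pos hm.pos hm.root (by have := hr0 n; positivity)
  have hκ1 : ∀ n, κ n ≤ 1 := fun n => hm.hfn_le_one (by have := hr0 n; positivity)
  have hκs : ∀ n, κ (n + 1) ≤ κ n := fun n => by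
    have := hr0 n
    refine hm.hfn_mono (by rw [hrs]; positivity) ?_
    rw [hrs]; gcongr; linarith
  have hsub : ∀ n, ball (0 : ℂ) (r n / 16) ⊆ ball 0 (r n / 8) := fun n =>
    ball_subset_ball (by linarith [hr0 n])
  have hsub' : ∀ n, ball (0 : ℂ) (r n / 16) = ball 0 (r (n + 1) / 8) := fun n => by
    rw [hrs]; congr 1; ring
  have hDd : ∀ n, DifferentiableOn ℂ (fun z => F (n + 1) z - F n z) (ball 0 (r n / 16)) := fun n =>
    DifferentiableOn.fun_sub (by rw [hsub']; exact hFd (n + 1)) ((hFd n).mono (hsub n))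
  have hDκ : ∀ n, ∀ z ∈ ball (0 : ℂ) (r n / 64), ‖F (n + 1) z - F n z‖ ≤ 2 * C * κ n := by
    intro n z hz
    have h := norm_sq_le_of_real_diameter (A := 2 * C) (η := 2 * C * κ n ^ 2)
      (by have := hr0 n; positivity) (hDd n)
      (fun z hz => (norm_sub_le _ _).trans (by
        have h1 := hFC n z (hsub n hz)
        have h2 := hFC (n + 1) z (hsub' n ▸ hz)
        linarith)) (by positivity)
      (mul_le_of_le_one_right (by positivity) (pow_le_one₀ (hκ0 n).le (hκ1 n)))
      (fun y hy => by
        have h1 := hFφ n y (by linarith [hr0 n])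
        have h2 := hFφ (n + 1) y (by rw [hrs]; linarith)
        rw [norm_sub_rev] at h1
        have h3 : hfn m (B * r (n + 1)) ^ 2 ≤ κ n ^ 2 := by
          have := hκ0 (n + 1)
          exact pow_le_pow_left₀ this.le (hκs n) 2
        have h4 : C * hfn m (B * r (n + 1)) ^ 2 ≤ C * κ n ^ 2 := by gcongr
        have h5 := norm_sub_le_norm_sub_add_norm_sub (F (n + 1) y) (φ y) (F n y)
        simp only [hκ] at h4 ⊢
        linarith)
      z (by convert hz using 2; ring)
    refine le_of_pow_le_pow_left₀ two_ne_zero (by have := hκ0 n; positivity) (h.trans ?_)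
    exact le_of_eq (by ring)
  choose P hPd hP using fun n => exists_polynomial_near (F := fun z => F (n + 1) z - F n z)
    (R := r n / 64) (by have := hr0 n; positivity)
    ((hDd n).mono (ball_subset_ball (by linarith [hr0 n]))) (hDκ n) k
  obtain ⟨Q, hQd, hQ⟩ := exists_polynomial_near (by have := hr0 0; positivity) (hFd 0) (hFC 0) k
  obtain ⟨n, hn1, hn2⟩ := exists_nat_pow_near_of_lt_one (x := 128 * τ / r₀) (y := (1 / 2 : ℝ))
    (by positivity) (by rw [div_le_one hr₀0]; linarith) (by norm_num) (by norm_num)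
  have hn1' : r n ≤ 256 * τ := by
    rw [lt_div_iff₀ hr₀0, pow_succ] at hn1
    simp only [hr]; linarith
  have hn2' : ∀ i ≤ n, 128 * τ ≤ r i := by
    intro i hi
    rw [div_le_iff₀ hr₀0] at hn2
    have : (1 / 2 : ℝ) ^ n ≤ (1 / 2) ^ i := pow_le_pow_of_le_one (by norm_num) (by norm_num) hi
    simp only [hr]
    nlinarith
  refine ⟨Q + ∑ i ∈ Finset.range n, P i, ?_, fun y hy => ?_⟩
  · have hs : ∑ i ∈ Finset.range n, P i ∈ Polynomial.degreeLT ℂ k :=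
      Submodule.sum_mem _ fun i _ => Polynomial.mem_degreeLT.2 (hPd i)
    exact Polynomial.mem_degreeLT.1 (Submodule.add_mem _ (Polynomial.mem_degreeLT.2 hQd) hs)
  have hyn : ‖(y : ℂ)‖ ≤ τ := by rw [Complex.norm_real]; exact hy
  have hball : ∀ i ≤ n, (y : ℂ) ∈ ball (0 : ℂ) (r i / 64) := fun i hi => by
    rw [mem_ball_zero_iff]; linarith [hn2' i hi]
  have hrn := hr0 n
  have hr00 : r 0 = r₀ := by simp [hr]
  have hb1 : ‖F n y - φ y‖ ≤ C * (256 * B) ^ k * m k * τ ^ k := by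
    have h1 := hFφ n y (by have := hn2' n le_rfl; linarith)
    calc ‖F n y - φ y‖ ≤ C * κ n ^ 2 := h1
      _ ≤ C * κ n := by
        gcongr
        have := hκ0 n
        have := hκ1 n
        nlinarith
      _ ≤ C * (m k * (B * r n) ^ k) := by gcongr; exact hfn_le hm.pos (by positivity) k
      _ ≤ C * (m k * (B * (256 * τ)) ^ k) := by gcongr
      _ = _ := by rw [mul_pow, mul_pow, mul_pow]; ring
  have hb2 : ‖F 0 y - Q.eval (y : ℂ)‖ ≤ C / hfn m 1 * (16 / r₀) ^ k * m k * τ ^ k := by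
    have h1 := hQ y (ball_subset_ball (by linarith [hr0 0]) (hball 0 (Nat.zero_le n)))
    have h2 : 1 ≤ m k / hfn m 1 := by
      rw [one_le_div hh1]
      simpa using hfn_le hm.pos one_pos k
    calc _ ≤ C * (2 * ‖(y : ℂ)‖ / (r 0 / 8)) ^ k := h1
      _ ≤ C * (2 * τ / (r 0 / 8)) ^ k := by rw [hr00]; gcongr
      _ = C * (16 / r₀) ^ k * τ ^ k * 1 := by
        rw [hr00, mul_one, mul_assoc, ← mul_pow]; congr 2; field_simp; norm_num
      _ ≤ C * (16 / r₀) ^ k * τ ^ k * (m k / hfn m 1) := by gcongr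
      _ = _ := by ring
  have hb3 : ∀ i ∈ Finset.range n, ‖(F (i + 1) y - F i y) - (P i).eval (y : ℂ)‖ ≤
      2 * C * B * ρ₀ * m 1 * (128 * B * ρ₀) ^ k * m k * τ ^ k * r i := by
    intro i hi
    have hri := hr0 i
    calc _ ≤ 2 * C * κ i * (2 * ‖(y : ℂ)‖ / (r i / 64)) ^ k :=
          hP i y (hball i (Finset.mem_range.1 hi).le)
      _ ≤ 2 * C * ((ρ₀ ^ (1 + k) * (m 1 * m k)) * (B * r i) ^ (1 + k)) *
          (2 * τ / (r i / 64)) ^ k := by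
        gcongr
        refine (hfn_le hm.pos (by positivity) (1 + k)).trans ?_
        gcongr
        exact hgr 1 k
      _ = 2 * C * B * ρ₀ * m 1 * m k * r i * ((ρ₀ ^ k) * (B * r i) ^ k * (2 * τ / (r i / 64)) ^ k) := by
        ring
      _ = _ := by
        rw [← mul_pow, ← mul_pow,
          show ρ₀ * (B * r i) * (2 * τ / (r i / 64)) = 128 * B * ρ₀ * τ by field_simp; ring, mul_pow]
        ring
  have hsum : ∑ i ∈ Finset.range n, r i ≤ 2 * r₀ := by
    simp only [hr]
    rw [← Finset.mul_sum]
    have := sum_geometric_two_le n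
    nlinarith
  have hid : φ y - (Q + ∑ i ∈ Finset.range n, P i).eval (y : ℂ) = -(F n y - φ y) +
      (F 0 y - Q.eval (y : ℂ)) +
      ∑ i ∈ Finset.range n, ((F (i + 1) y - F i y) - (P i).eval (y : ℂ)) := by
    rw [Finset.sum_sub_distrib, Finset.sum_range_sub (fun i => F i y), Polynomial.eval_add,
      Polynomial.eval_finsetSum]
    ring
  set L := 256 * B + 16 / r₀ + 128 * B * ρ₀ with hL
  have hL1 : (256 * B) ^ k ≤ L ^ k := by
    gcongr
    rw [hL, add_assoc]
    exact le_add_of_nonneg_right (by positivity)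
  have hL2 : (16 / r₀) ^ k ≤ L ^ k := by
    gcongr
    rw [hL, add_right_comm]
    exact le_add_of_nonneg_left (by positivity)
  have hL3 : (128 * B * ρ₀) ^ k ≤ L ^ k := by
    gcongr
    exact le_add_of_nonneg_left (by positivity)
  rw [hid]
  calc _ ≤ C * (256 * B) ^ k * m k * τ ^ k + C / hfn m 1 * (16 / r₀) ^ k * m k * τ ^ k +
      ∑ i ∈ Finset.range n, 2 * C * B * ρ₀ * m 1 * (128 * B * ρ₀) ^ k * m k * τ ^ k * r i := by
        refine (norm_add₃_le).trans ?_
        rw [norm_neg]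
        gcongr
        exact norm_sum_le_of_le _ hb3
    _ ≤ C * (256 * B) ^ k * m k * τ ^ k + C / hfn m 1 * (16 / r₀) ^ k * m k * τ ^ k +
      2 * C * B * ρ₀ * m 1 * (128 * B * ρ₀) ^ k * m k * τ ^ k * (2 * r₀) := by
        rw [← Finset.mul_sum]; gcongr
    _ ≤ C * L ^ k * m k * τ ^ k + C / hfn m 1 * L ^ k * m k * τ ^ k +
      2 * C * B * ρ₀ * m 1 * L ^ k * m k * τ ^ k * (2 * r₀) := by gcongr
    _ = _ := by ring

/-- The `k`-th forward difference at `0` of a sequence. -/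
def altSum (k : ℕ) (a : ℕ → ℂ) : ℂ :=
  ∑ i ∈ Finset.range (k + 1), ((-1) ^ (k - i) * (k.choose i : ℂ)) * a i

lemma altSum_sub (k : ℕ) (a b : ℕ → ℂ) :
    altSum k (fun i => a i - b i) = altSum k a - altSum k b := by
  simp only [altSum, mul_sub, Finset.sum_sub_distrib]

lemma norm_altSum_le {k : ℕ} {a : ℕ → ℂ} {B : ℝ} (h : ∀ i ≤ k, ‖a i‖ ≤ B) :
    ‖altSum k a‖ ≤ 2 ^ k * B := by
  calc ‖altSum k a‖ ≤ ∑ i ∈ Finset.range (k + 1), (k.choose i : ℝ) * B := by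
        refine norm_sum_le_of_le _ fun i hi => ?_
        rw [norm_mul, norm_mul, norm_pow, norm_neg, norm_one, one_pow, one_mul, Complex.norm_natCast]
        exact mul_le_mul_of_nonneg_left (h i (Finset.mem_range_succ_iff.1 hi)) (by positivity)
    _ = 2 ^ k * B := by
        rw [← Finset.sum_mul]
        congr 1
        exact_mod_cast Nat.sum_range_choose k

lemma altSum_eq_fwdDiff (k : ℕ) (g : ℂ → ℂ) :
    altSum k (fun i => g i) = (fwdDiff (1 : ℂ))^[k] g 0 := by
  rw [fwdDiff_iter_eq_sum_shift, altSum]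
  refine Finset.sum_congr rfl fun i _ => ?_
  simp

lemma altSum_eval_eq_zero {k : ℕ} {P : Polynomial ℂ} (hP : P.degree < k) (t : ℂ) :
    altSum k (fun i => P.eval (i * t)) = 0 := by
  have h : (fun i : ℕ => P.eval (i * t)) =
      fun i : ℕ => (fun z : ℂ => ∑ n ∈ Finset.range k, (P.coeff n * t ^ n) * z ^ n) (i : ℂ) := by
    funext i
    rw [Polynomial.eval_eq_sum_range' (n := k + 1)
      (Nat.lt_succ_of_le (Polynomial.natDegree_le_of_degree_le hP.le)), Finset.sum_range_succ,
      Polynomial.coeff_eq_zero_of_degree_lt hP, zero_mul, add_zero]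
    exact Finset.sum_congr rfl fun n _ => by rw [mul_pow]; ring
  rw [h, altSum_eq_fwdDiff k (fun z : ℂ => ∑ n ∈ Finset.range k, (P.coeff n * t ^ n) * z ^ n),
    fwdDiff_iter_sum_mul_pow_eq_zero (fun n => P.coeff n * t ^ n)]
  rfl

lemma altSum_sum_pow (k : ℕ) (c : ℕ → ℂ) (t : ℂ) :
    altSum k (fun i => ∑ n ∈ Finset.range (k + 1), c n * (i * t) ^ n) =
      c k * t ^ k * (k.factorial : ℂ) := by
  have h : (fun i : ℕ => ∑ n ∈ Finset.range (k + 1), c n * (i * t) ^ n) =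
      fun i : ℕ => ((fun z : ℂ => ∑ n ∈ Finset.range k, (c n * t ^ n) * z ^ n) +
        (c k * t ^ k) • fun z : ℂ => z ^ k) (i : ℂ) := by
    funext i
    rw [Finset.sum_range_succ]
    simp only [Pi.add_apply, Pi.smul_apply, smul_eq_mul, mul_pow]
    congr 1
    · exact Finset.sum_congr rfl fun n _ => by ring
    · ring
  rw [h, altSum_eq_fwdDiff k, fwdDiff_iter_add, fwdDiff_iter_const_smul,
    fwdDiff_iter_sum_mul_pow_eq_zero (fun n => c n * t ^ n), fwdDiff_iter_eq_factorial]
  simp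

lemma succ_pow_le_factorial_mul_exp (k : ℕ) :
    ((k : ℝ) + 1) ^ k ≤ k.factorial * (Real.exp 1 * Real.exp 1 ^ k) := by
  have h := Real.pow_div_factorial_le_exp (x := (k : ℝ) + 1) (by positivity) k
  rw [div_le_iff₀ (by positivity)] at h
  rw [← Real.exp_nat_mul, ← Real.exp_add]
  calc _ ≤ _ := h
    _ = _ := by rw [mul_comm]; congr 2; ring

/-- Forward differences of `φ` are controlled by those of `φ ^ j` and `φ ^ (j + 1)`. -/
lemma exists_norm_altSum_le {m : ℕ → ℝ} (hm : AdmissibleSeq m) {j : ℕ} (hj : 1 ≤ j) {A ρ R : ℝ}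
    (hA : 1 ≤ A) (hρ : 0 < ρ) (hR : 0 < R) :
    ∃ C ρ' τ₀ : ℝ, 0 < C ∧ 0 < ρ' ∧ 0 < τ₀ ∧ ∀ φ : ℝ → ℂ, JetBound m A ρ R (fun y => φ y ^ j) →
      JetBound m A ρ R (fun y => φ y ^ (j + 1)) → ∀ (k : ℕ) (t : ℝ), 0 < t → (k + 1) * t ≤ τ₀ →
        ‖altSum k (fun i => φ (i * t))‖ ≤ C * ρ' ^ k * (k.factorial * m k) * t ^ k := by
  obtain ⟨C, ρ', τ₀, hC, hρ', hτ₀, h⟩ := exists_polynomial_approx hm hj hA hρ hR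
  refine ⟨C * Real.exp 1, 2 * Real.exp 1 * ρ', τ₀, by positivity, by positivity, hτ₀,
    fun φ h1 h2 k t ht hkt => ?_⟩
  obtain ⟨P, hP, hPφ⟩ := h φ h1 h2 k ((k + 1) * t) (by positivity) hkt
  have hmk := hm.pos k
  have h0 : altSum k (fun i => φ (i * t)) =
      altSum k (fun i => φ (i * t) - P.eval ((i : ℂ) * t)) := by
    rw [altSum_sub, altSum_eval_eq_zero hP, sub_zero]
  rw [h0]
  calc _ ≤ 2 ^ k * (C * ρ' ^ k * m k * ((k + 1) * t) ^ k) := by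
        refine norm_altSum_le fun i hi => ?_
        have := hPφ (i * t) (by
          rw [abs_of_nonneg (by positivity)]
          gcongr
          have : (i : ℝ) ≤ k := by exact_mod_cast hi
          linarith)
        simpa using this
    _ = 2 ^ k * (C * ρ' ^ k * m k * t ^ k) * ((k : ℝ) + 1) ^ k := by rw [mul_pow]; ring
    _ ≤ 2 ^ k * (C * ρ' ^ k * m k * t ^ k) * (k.factorial * (Real.exp 1 * Real.exp 1 ^ k)) := by
        gcongr; exact succ_pow_le_factorial_mul_exp k
    _ = _ := by simp only [mul_pow]; ring

section Symmetry

variable {E F : Type*} [NormedAddCommGroup E] [NormedSpace ℝ E] [NormedAddCommGroup F]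
  [NormedSpace ℝ F]

lemma hasFDerivAt_iteratedFDeriv_apply {f : E → F} (hf : ContDiff ℝ (⊤ : ℕ∞) f) (n : ℕ) (x : E)
    (u : Fin n → E) :
    HasFDerivAt (fun y => iteratedFDeriv ℝ n f y u)
      ((ContinuousMultilinearMap.apply ℝ (fun _ : Fin n => E) F u).comp
        (fderiv ℝ (iteratedFDeriv ℝ n f) x)) x := by
  have h1 : DifferentiableAt ℝ (iteratedFDeriv ℝ n f) x :=
    (hf.differentiable_iteratedFDeriv (by exact_mod_cast WithTop.coe_lt_top n)) x
  exact (ContinuousMultilinearMap.apply ℝ (fun _ : Fin n => E) F u).hasFDerivAt.comp x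
    h1.hasFDerivAt

lemma fderiv_iteratedFDeriv_apply {f : E → F} (hf : ContDiff ℝ (⊤ : ℕ∞) f) (n : ℕ) (x a : E)
    (u : Fin n → E) : fderiv ℝ (iteratedFDeriv ℝ n f) x a u =
      fderiv ℝ (fun y => iteratedFDeriv ℝ n f y u) x a := by
  rw [(hasFDerivAt_iteratedFDeriv_apply hf n x u).fderiv]; rfl

/-- The iterated derivatives of a smooth function are symmetric. -/
lemma iteratedFDeriv_comp_perm_of_contDiff {f : E → F} (hf : ContDiff ℝ (⊤ : ℕ∞) f) (n : ℕ) (x : E)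
    (v : Fin n → E) (σ : Equiv.Perm (Fin n)) :
    iteratedFDeriv ℝ n f x (v ∘ σ) = iteratedFDeriv ℝ n f x v := by
  induction n generalizing x with
  | zero => rw [Subsingleton.elim (v ∘ σ) v]
  | succ n ih =>
    have hσ : σ ∈ Submonoid.closure
        (Set.range fun i : Fin n => Equiv.swap i.castSucc i.succ) := by
      rw [Equiv.Perm.mclosure_swap_castSucc_succ]; trivial
    induction hσ using Submonoid.closure_induction generalizing v with
    | one => rfl
    | mul σ τ _ _ h1 h2 =>
      rw [show v ∘ (σ * τ : Equiv.Perm (Fin (n + 1))) = (v ∘ σ) ∘ τ from rfl, h2, h1]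
    | mem σ hσ =>
      obtain ⟨i, rfl⟩ := hσ
      rw [iteratedFDeriv_succ_apply_left, iteratedFDeriv_succ_apply_left]
      cases n with
      | zero => exact i.elim0
      | succ n =>
        refine Fin.cases ?_ (fun i => ?_) i
        · have key : ∀ w : Fin (n + 2) → E,
              fderiv ℝ (iteratedFDeriv ℝ (n + 1) f) x (w 0) (Fin.tail w) =
              fderiv ℝ (fderiv ℝ (iteratedFDeriv ℝ n f)) x (w 0) (w 1) (fun i => w i.succ.succ) := by
            intro w
            have h2 : DifferentiableAt ℝ (fderiv ℝ (iteratedFDeriv ℝ n f)) x := by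
              have : ContDiff ℝ 2 (iteratedFDeriv ℝ n f) :=
                (contDiff_infty.1 hf (2 + n)).iteratedFDeriv_right (by push_cast; exact le_rfl)
              exact (this.fderiv_right (m := 1) (by norm_num)).differentiable (by norm_num) x
            rw [fderiv_iteratedFDeriv_apply hf]
            simp only [iteratedFDeriv_succ_apply_left]
            have h3 := (h2.hasFDerivAt.clm_apply (hasFDerivAt_const (Fin.tail w 0) x)
              ).continuousMultilinear_apply_const (Fin.tail (Fin.tail w))
            rw [h3.fderiv]
            simp [Fin.tail]
            rfl
          rw [key, key]
          have hs : IsSymmSndFDerivAt ℝ (iteratedFDeriv ℝ n f) x := by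
            have : ContDiff ℝ 2 (iteratedFDeriv ℝ n f) :=
              (contDiff_infty.1 hf (2 + n)).iteratedFDeriv_right (by push_cast; exact le_rfl)
            exact this.contDiffAt.isSymmSndFDerivAt (by simp)
          have e0 : (Equiv.swap (Fin.castSucc (0 : Fin (n + 1))) (Fin.succ 0)) 0 = 1 := by simp
          have e1 : (Equiv.swap (Fin.castSucc (0 : Fin (n + 1))) (Fin.succ 0)) 1 = 0 := by simp
          have e2 : ∀ k : Fin n,
              (Equiv.swap (Fin.castSucc (0 : Fin (n + 1))) (Fin.succ 0)) k.succ.succ = k.succ.succ := by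
            intro k
            refine Equiv.swap_apply_of_ne_of_ne ?_ ?_ <;> simp [Fin.ext_iff]
          simp only [Function.comp_apply, e0, e1, e2]
          rw [hs.eq]
        · have h0 : Equiv.swap (Fin.castSucc i.succ) (Fin.succ i.succ) 0 = (0 : Fin (n + 2)) := by
            refine Equiv.swap_apply_of_ne_of_ne ?_ ?_ <;> simp [Fin.ext_iff]
          have ht : Fin.tail (v ∘ Equiv.swap (Fin.castSucc i.succ) (Fin.succ i.succ)) =
              Fin.tail v ∘ Equiv.swap i.castSucc i.succ := by
            funext k
            simp only [Fin.tail, Function.comp_apply]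
            congr 1
            rw [← Fin.succ_castSucc]
            exact (Fin.succ_injective _).swap_apply i.castSucc i.succ k
          rw [ht, Function.comp_apply, h0, fderiv_iteratedFDeriv_apply hf,
            fderiv_iteratedFDeriv_apply hf]
          simp only [ih]

end Symmetry

section Polarization

variable {E F : Type*} [NormedAddCommGroup E] [NormedSpace ℝ E] [NormedAddCommGroup F]
  [NormedSpace ℝ F]

lemma sum_univ_neg_one_pow_card_compl (k : ℕ) (r : Fin k → Fin k) :
    ∑ S : Finset (Fin k), (if ∀ i, r i ∈ S then (-1 : ℤ) ^ (Sᶜ).card else 0) =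
      if Function.Surjective r then 1 else 0 := by
  classical
  have h1 : ∑ S : Finset (Fin k), (if ∀ i, r i ∈ S then (-1 : ℤ) ^ (Sᶜ).card else 0) =
      ∑ T ∈ ((Finset.univ.image r)ᶜ).powerset, (-1 : ℤ) ^ T.card := by
    rw [← Finset.sum_filter]
    refine Finset.sum_bij' (fun S _ => Sᶜ) (fun T _ => Tᶜ) ?_ ?_ ?_ ?_ ?_
    · intro S hS
      rw [Finset.mem_powerset, Finset.compl_subset_compl]
      intro y hy
      obtain ⟨i, -, rfl⟩ := Finset.mem_image.1 hy
      exact (Finset.mem_filter.1 hS).2 i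
    · intro T hT
      refine Finset.mem_filter.2 ⟨Finset.mem_univ _, fun i => ?_⟩
      rw [Finset.mem_compl]
      intro hi
      exact Finset.mem_compl.1 (Finset.mem_powerset.1 hT hi)
        (Finset.mem_image_of_mem r (Finset.mem_univ i))
    · simp
    · simp
    · simp
  rw [h1, Finset.sum_powerset_neg_one_pow_card]
  congr 1
  simp [Finset.compl_eq_empty_iff, Finset.eq_univ_iff_forall, Function.Surjective]

/-- The polarization identity for symmetric multilinear maps. -/
lemma sum_neg_one_pow_smul_map_sum (k : ℕ)
    (T : ContinuousMultilinearMap ℝ (fun _ : Fin k => E) F)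
    (hT : ∀ (v : Fin k → E) (σ : Equiv.Perm (Fin k)), T (v ∘ σ) = T v) (v : Fin k → E) :
    ∑ S : Finset (Fin k), (-1 : ℤ) ^ (Sᶜ).card • T (fun _ => ∑ i ∈ S, v i) =
      k.factorial • T v := by
  classical
  have h1 : ∀ S : Finset (Fin k), (-1 : ℤ) ^ (Sᶜ).card • T (fun _ => ∑ i ∈ S, v i) =
      ∑ r : Fin k → Fin k, (if ∀ i, r i ∈ S then (-1 : ℤ) ^ (Sᶜ).card else 0) • T (v ∘ r) := by
    intro S
    rw [T.map_sum_finset (fun _ => v) (fun _ => S), Finset.smul_sum]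
    rw [← Finset.sum_subset (Finset.subset_univ (Fintype.piFinset fun _ : Fin k => S))]
    · refine Finset.sum_congr rfl fun r hr => ?_
      rw [if_pos (Fintype.mem_piFinset.1 hr)]; rfl
    · intro r _ hr
      rw [if_neg (fun h => hr (Fintype.mem_piFinset.2 h)), zero_smul]
  simp_rw [h1]
  rw [Finset.sum_comm]
  simp_rw [← Finset.sum_smul, sum_univ_neg_one_pow_card_compl, ite_smul, one_smul, zero_smul]
  rw [← Finset.sum_filter]
  have h2 : ∀ r ∈ Finset.univ.filter (fun r : Fin k → Fin k => Function.Surjective r),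
      T (v ∘ r) = T v := by
    intro r hr
    have hb := Finite.surjective_iff_bijective.1 (Finset.mem_filter.1 hr).2
    exact hT v (Equiv.ofBijective r hb)
  rw [Finset.sum_congr rfl h2, Finset.sum_const]
  congr 1
  rw [← Fintype.card_subtype]
  calc Fintype.card {r : Fin k → Fin k // Function.Surjective r}
      = Fintype.card (Equiv.Perm (Fin k)) := by
        refine Fintype.card_congr ⟨fun r => Equiv.ofBijective r.1
          (Finite.surjective_iff_bijective.1 r.2), fun σ => ⟨σ, σ.surjective⟩, fun r => rfl,
          fun σ => Equiv.ext fun i => rfl⟩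
    _ = k.factorial := by rw [Fintype.card_perm, Fintype.card_fin]

lemma norm_le_of_norm_apply_diagonal_le {k : ℕ}
    {T : ContinuousMultilinearMap ℝ (fun _ : Fin k => E) F}
    (hT : ∀ (v : Fin k → E) (σ : Equiv.Perm (Fin k)), T (v ∘ σ) = T v) {C : ℝ}
    (hC : ∀ v : E, ‖v‖ ≤ 1 → ‖T (fun _ => v)‖ ≤ C) :
    ‖T‖ ≤ (2 * Real.exp 1) ^ k * C := by
  have hC0 : 0 ≤ C := (norm_nonneg _).trans (hC 0 (by simp))
  have hdiag : ∀ v : E, ‖T (fun _ => v)‖ ≤ C * ‖v‖ ^ k := by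
    intro v
    rcases eq_or_ne v 0 with rfl | hv
    · cases k with
      | zero => simpa using hC 0 (by simp)
      | succ k => rw [T.map_coord_zero (0 : Fin (k + 1)) rfl]; simp
    · have hv0 := norm_pos_iff.2 hv
      have h1 : (fun _ : Fin k => v) = fun _ => ‖v‖ • (‖v‖⁻¹ • v) := by
        funext _; rw [smul_inv_smul₀ hv0.ne']
      rw [h1, T.map_smul_univ (fun _ => ‖v‖) (fun _ => ‖v‖⁻¹ • v), norm_smul]
      simp only [Finset.prod_const, Finset.card_univ, Fintype.card_fin, norm_pow, norm_norm]
      rw [mul_comm]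
      gcongr
      refine hC _ ?_
      rw [norm_smul, norm_inv, norm_norm, inv_mul_cancel₀ hv0.ne']
  have hunit : ∀ v : Fin k → E, (∀ i, ‖v i‖ ≤ 1) → ‖T v‖ ≤ (2 * Real.exp 1) ^ k * C := by
    intro v hv
    have h1 : (k.factorial : ℝ) * ‖T v‖ ≤ 2 ^ k * (C * (k : ℝ) ^ k) := by
      calc (k.factorial : ℝ) * ‖T v‖ = ‖k.factorial • T v‖ := by
            rw [← Nat.cast_smul_eq_nsmul ℝ, norm_smul, Real.norm_natCast]
        _ = ‖∑ S : Finset (Fin k), (-1 : ℤ) ^ (Sᶜ).card • T (fun _ => ∑ i ∈ S, v i)‖ := by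
            rw [sum_neg_one_pow_smul_map_sum k T hT v]
        _ ≤ ∑ S : Finset (Fin k), C * (k : ℝ) ^ k := by
            refine norm_sum_le_of_le _ fun S _ => ?_
            have h2 : ‖∑ i ∈ S, v i‖ ≤ k := by
              calc ‖∑ i ∈ S, v i‖ ≤ ∑ i ∈ S, (1 : ℝ) := norm_sum_le_of_le _ fun i _ => hv i
                _ ≤ k := by
                  rw [Finset.sum_const, nsmul_eq_mul, mul_one]
                  exact_mod_cast (Finset.card_le_univ S).trans_eq (Fintype.card_fin k)
            rw [← Int.cast_smul_eq_zsmul ℝ, norm_smul]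
            push_cast
            rw [norm_pow, norm_neg, norm_one, one_pow, one_mul]
            exact (hdiag _).trans (by gcongr)
        _ = _ := by simp
    have h2 := Real.pow_div_factorial_le_exp (x := (k : ℝ)) (by positivity) k
    have h3 : (0 : ℝ) < k.factorial := by positivity
    rw [div_le_iff₀ h3] at h2
    have h4 : Real.exp k = Real.exp 1 ^ k := by rw [← Real.exp_nat_mul, mul_one]
    refine le_of_mul_le_mul_left (h1.trans ?_) h3
    calc (2 : ℝ) ^ k * (C * (k : ℝ) ^ k) ≤ 2 ^ k * (C * (Real.exp k * k.factorial)) := by gcongr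
      _ = _ := by rw [h4, mul_pow]; ring
  refine ContinuousMultilinearMap.opNorm_le_bound (by positivity) fun v => ?_
  by_cases h0 : ∃ i, v i = 0
  · obtain ⟨i, hi⟩ := h0
    rw [T.map_coord_zero i hi, norm_zero]
    positivity
  · push Not at h0
    have h1 : v = fun i => ‖v i‖ • (‖v i‖⁻¹ • v i) := by
      funext i; rw [smul_inv_smul₀ (norm_ne_zero_iff.2 (h0 i))]
    conv_lhs => rw [h1]
    rw [T.map_smul_univ (fun i => ‖v i‖) (fun i => ‖v i‖⁻¹ • v i), norm_smul, mul_comm, norm_prod]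
    simp only [norm_norm]
    gcongr
    refine hunit _ fun i => ?_
    rw [norm_smul, norm_inv, norm_norm, inv_mul_cancel₀ (norm_ne_zero_iff.2 (h0 i))]

end Polarization

section Taylor

variable {E : Type*} [NormedAddCommGroup E] [NormedSpace ℝ E]

lemma norm_sub_taylor_le {f : E → ℂ} {x y : E} {N : ℕ} {B : ℝ}
    (hf : ∀ t ∈ Icc (0 : ℝ) 1, ContDiffAt ℝ (⊤ : ℕ∞) f (x + t • y))
    (hB : ∀ t ∈ Icc (0 : ℝ) 1, ‖iteratedFDeriv ℝ N f (x + t • y)‖ ≤ B) :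
    ‖f (x + y) - ∑ k ∈ Finset.range N, ((k.factorial : ℝ)⁻¹) • iteratedFDeriv ℝ k f x (fun _ => y)‖
      ≤ B * ‖y‖ ^ N / N.factorial := by
  cases N with
  | zero => simpa using hB 1 (by simp)
  | succ n =>
    rw [map_add_eq_sum_add_integral_iteratedFDeriv (n := n)
      (fun t ht => (hf t ht).of_le (by exact_mod_cast le_top)), add_sub_cancel_left, norm_smul]
    have hint : ‖∫ t in (0 : ℝ)..1, (1 - t) ^ n • iteratedFDeriv ℝ (n + 1) f (x + t • y) fun _ => y‖
        ≤ ∫ t in (0 : ℝ)..1, (1 - t) ^ n * (B * ‖y‖ ^ (n + 1)) := by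
      refine intervalIntegral.norm_integral_le_of_norm_le zero_le_one ?_ ?_
      · refine Filter.Eventually.of_forall fun t ht => ?_
        have h1 : 0 ≤ 1 - t := by linarith [ht.2]
        rw [norm_smul, norm_pow, Real.norm_of_nonneg h1]
        gcongr
        refine (ContinuousMultilinearMap.le_opNorm _ _).trans ?_
        rw [Finset.prod_const, Finset.card_univ, Fintype.card_fin]
        gcongr
        exact hB t ⟨ht.1.le, ht.2⟩
      · exact (by fun_prop : Continuous fun t : ℝ =>
          (1 - t) ^ n * (B * ‖y‖ ^ (n + 1))).intervalIntegrable _ _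
    have hval : ∫ t in (0 : ℝ)..1, (1 - t) ^ n * (B * ‖y‖ ^ (n + 1)) =
        (B * ‖y‖ ^ (n + 1)) / (n + 1) := by
      rw [intervalIntegral.integral_mul_const,
        intervalIntegral.integral_comp_sub_left (fun t : ℝ => t ^ n) 1, integral_pow]
      simp
      ring
    rw [hval] at hint
    calc _ ≤ ‖((n.factorial : ℝ))⁻¹‖ * ((B * ‖y‖ ^ (n + 1)) / (n + 1)) := by gcongr
      _ = _ := by
        rw [Real.norm_of_nonneg (by positivity), Nat.factorial_succ]
        push_cast
        field_simp

lemma iteratedFDeriv_apply_smul_const (f : E → ℂ) (k : ℕ) (x v : E) (s : ℝ) :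
    iteratedFDeriv ℝ k f x (fun _ => s • v) = (s : ℂ) ^ k * iteratedFDeriv ℝ k f x (fun _ => v) := by
  rw [(iteratedFDeriv ℝ k f x).map_smul_univ (fun _ => s) (fun _ => v)]
  simp

lemma norm_iteratedFDeriv_diagonal_le (f : E → ℂ) (k : ℕ) (x : E) {v : E} (hv : ‖v‖ ≤ 1) :
    ‖iteratedFDeriv ℝ k f x (fun _ => v)‖ ≤ ‖iteratedFDeriv ℝ k f x‖ := by
  refine (ContinuousMultilinearMap.le_opNorm _ _).trans ?_
  refine mul_le_of_le_one_right (norm_nonneg _) ?_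
  exact Finset.prod_le_one (fun _ _ => norm_nonneg _) fun _ _ => hv

lemma jetBound_of_iteratedFDeriv_le {M : ℕ → ℝ} {f : E → ℂ} {x v : E} {A ρ R : ℝ} (hR : 0 < R)
    (hv : ‖v‖ ≤ 1) (hM : ∀ k, 0 < M k) (hA : 0 ≤ A) (hρ : 0 < ρ)
    (hf : ∀ s : ℝ, |s| < R → ContDiffAt ℝ (⊤ : ℕ∞) f (x + s • v))
    (hb : ∀ s : ℝ, |s| < R → ∀ k, ‖iteratedFDeriv ℝ k f (x + s • v)‖ ≤ A * ρ ^ k * M k) :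
    JetBound (lc M) A ρ R (fun s => f (x + s • v)) := by
  refine ⟨fun k => (k.factorial : ℂ)⁻¹ * iteratedFDeriv ℝ k f x (fun _ => v), fun k => ?_,
    fun N s hs => ?_⟩
  · rw [norm_mul, norm_inv, Complex.norm_natCast, lc]
    have := (norm_iteratedFDeriv_diagonal_le f k x hv).trans (by simpa using hb 0 (by simpa) k)
    calc _ ≤ (k.factorial : ℝ)⁻¹ * (A * ρ ^ k * M k) := by gcongr
      _ = _ := by field_simp
  · have hseg : ∀ t ∈ Icc (0 : ℝ) 1, |t * s| < R := fun t ht => by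
      rw [abs_mul, abs_of_nonneg ht.1]
      exact (mul_le_of_le_one_left (abs_nonneg _) ht.2).trans_lt hs
    have h := norm_sub_taylor_le (f := f) (x := x) (y := s • v) (N := N) (B := A * ρ ^ N * M N)
      (fun t ht => by rw [smul_smul]; exact hf _ (hseg t ht))
      (fun t ht => by rw [smul_smul]; exact hb _ (hseg t ht) N)
    have he : ∑ k ∈ Finset.range N, (k.factorial : ℂ)⁻¹ * iteratedFDeriv ℝ k f x (fun _ => v) *
        (s : ℂ) ^ k = ∑ k ∈ Finset.range N,
          ((k.factorial : ℝ)⁻¹) • iteratedFDeriv ℝ k f x (fun _ => s • v) := by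
      refine Finset.sum_congr rfl fun k _ => ?_
      rw [iteratedFDeriv_apply_smul_const, Complex.real_smul]
      push_cast
      ring
    simp only [he]
    refine h.trans ?_
    have hMN := hM N
    rw [norm_smul, Real.norm_eq_abs, lc]
    calc _ ≤ A * ρ ^ N * M N * (|s| * 1) ^ N / N.factorial := by gcongr
      _ = _ := by rw [mul_one]; ring

lemma norm_iteratedFDeriv_diagonal_le_of_altSum {f : E → ℂ} (hf : ContDiff ℝ (⊤ : ℕ∞) f) {x v : E}
    {k : ℕ} {D t₀ : ℝ} (ht₀ : 0 < t₀)
    (h : ∀ t : ℝ, 0 < t → t < t₀ → ‖altSum k (fun i => f (x + ((i : ℝ) * t) • v))‖ ≤ D * t ^ k) :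
    ‖iteratedFDeriv ℝ k f x (fun _ => v)‖ ≤ D := by
  have hcont : ContinuousOn (fun s : ℝ => iteratedFDeriv ℝ (k + 1) f (x + s • v)) (Icc 0 1) := by
    have := hf.continuous_iteratedFDeriv (m := k + 1) (by exact_mod_cast le_top)
    exact (this.comp (by fun_prop)).continuousOn
  obtain ⟨B, hB⟩ := isCompact_Icc.exists_bound_of_continuousOn hcont
  have hB0 : 0 ≤ B := (norm_nonneg _).trans (hB 0 (by simp))
  set Q : ℝ := 2 ^ k * (B * (k * ‖v‖) ^ (k + 1)) with hQ
  have hQ0 : 0 ≤ Q := by positivity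
  have key : ∀ t : ℝ, 0 < t → t < t₀ → k * t ≤ 1 →
      ‖iteratedFDeriv ℝ k f x (fun _ => v)‖ ≤ D + Q * t := by
    intro t ht htt hkt
    set c : ℕ → ℂ := fun n => (n.factorial : ℂ)⁻¹ * iteratedFDeriv ℝ n f x (fun _ => v) with hc
    have hrem : ∀ i ≤ k, ‖f (x + ((i : ℝ) * t) • v) -
        ∑ n ∈ Finset.range (k + 1), c n * ((i : ℂ) * t) ^ n‖ ≤ B * (k * t * ‖v‖) ^ (k + 1) := by
      intro i hi
      have hik : (i : ℝ) * t ≤ k * t := by gcongr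
      have hit : 0 ≤ (i : ℝ) * t := by positivity
      have h1 := norm_sub_taylor_le (f := f) (x := x) (y := ((i : ℝ) * t) • v) (N := k + 1) (B := B)
        (fun s _ => hf.contDiffAt)
        (fun s hs => by
          rw [smul_smul]
          exact hB _ ⟨mul_nonneg hs.1 hit, (mul_le_of_le_one_left hit hs.2).trans (hik.trans hkt)⟩)
      have he : ∑ n ∈ Finset.range (k + 1), c n * ((i : ℂ) * t) ^ n =
          ∑ n ∈ Finset.range (k + 1),
            ((n.factorial : ℝ)⁻¹) • iteratedFDeriv ℝ n f x (fun _ => ((i : ℝ) * t) • v) := by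
        refine Finset.sum_congr rfl fun n _ => ?_
        rw [iteratedFDeriv_apply_smul_const, Complex.real_smul, hc]
        push_cast
        ring
      rw [he]
      refine h1.trans ?_
      rw [norm_smul, Real.norm_of_nonneg hit]
      calc _ ≤ B * (i * t * ‖v‖) ^ (k + 1) := by
            refine div_le_self (by positivity) ?_
            exact_mod_cast Nat.one_le_iff_ne_zero.2 (Nat.factorial_ne_zero _)
        _ ≤ _ := by gcongr
    have h2 := norm_altSum_le hrem
    rw [altSum_sub, altSum_sum_pow] at h2
    have h3 : c k * (t : ℂ) ^ k * (k.factorial : ℂ) =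
        iteratedFDeriv ℝ k f x (fun _ => v) * (t : ℂ) ^ k := by
      have : (k.factorial : ℂ) ≠ 0 := by exact_mod_cast Nat.factorial_ne_zero k
      simp only [hc]
      field_simp
    rw [h3] at h2
    have h4 : ‖iteratedFDeriv ℝ k f x (fun _ => v)‖ * t ^ k ≤ (D + Q * t) * t ^ k := by
      calc _ = ‖iteratedFDeriv ℝ k f x (fun _ => v) * (t : ℂ) ^ k‖ := by
            rw [norm_mul, norm_pow, Complex.norm_real, Real.norm_of_nonneg ht.le]
        _ ≤ ‖altSum k (fun i => f (x + ((i : ℝ) * t) • v))‖ +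
            ‖altSum k (fun i => f (x + ((i : ℝ) * t) • v)) -
              iteratedFDeriv ℝ k f x (fun _ => v) * (t : ℂ) ^ k‖ := by
            have := norm_sub_le (altSum k (fun i => f (x + ((i : ℝ) * t) • v)))
              (altSum k (fun i => f (x + ((i : ℝ) * t) • v)) -
                iteratedFDeriv ℝ k f x (fun _ => v) * (t : ℂ) ^ k)
            rwa [sub_sub_cancel] at this
        _ ≤ D * t ^ k + 2 ^ k * (B * (k * t * ‖v‖) ^ (k + 1)) := add_le_add (h t ht htt) h2
        _ = _ := by rw [hQ]; simp only [mul_pow, pow_succ]; ring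
    exact le_of_mul_le_mul_right h4 (by positivity)
  refine le_of_forall_pos_le_add fun ε hε => ?_
  obtain ⟨t, ht, ht1, ht2, ht3⟩ : ∃ t : ℝ, 0 < t ∧ t < t₀ ∧ k * t ≤ 1 ∧ Q * t ≤ ε := by
    refine ⟨min (t₀ / 2) (min (1 / (k + 1)) (ε / (Q + 1))), by positivity, ?_, ?_, ?_⟩
    · exact (min_le_left _ _).trans_lt (by linarith)
    · calc (k : ℝ) * _ ≤ (k + 1) * (1 / (k + 1)) := by
            gcongr
            · linarith
            · exact (min_le_right _ _).trans (min_le_left _ _)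
        _ = 1 := by field_simp
    · calc Q * _ ≤ (Q + 1) * (ε / (Q + 1)) := by
            gcongr
            · linarith
            · exact (min_le_right _ _).trans (min_le_right _ _)
        _ = ε := by field_simp
  linarith [key t ht ht1 ht2]

end Taylor

section SmoothLimit

universe u

variable {E : Type u} [NormedAddCommGroup E] [NormedSpace ℝ E]

lemma norm_image_sub_sub_fderiv_le {F : Type*} [NormedAddCommGroup F] [NormedSpace ℝ F] {f : E → F}
    (hf : ContDiff ℝ (⊤ : ℕ∞) f) {x₀ x w : E} {r B : ℝ}
    (hB : ∀ y ∈ ball x₀ r, ‖iteratedFDeriv ℝ 2 f y‖ ≤ B) (hx : x ∈ ball x₀ r)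
    (hw : x + w ∈ ball x₀ r) : ‖f (x + w) - f x - fderiv ℝ f x w‖ ≤ B * ‖w‖ * ‖w‖ := by
  have hd : Differentiable ℝ (fderiv ℝ f) :=
    ((contDiff_infty.1 hf 2).fderiv_right (m := 1) (by norm_num)).differentiable (by norm_num)
  have hB0 : 0 ≤ B := (norm_nonneg _).trans (hB x hx)
  have h1 : ∀ y ∈ ball x₀ r, ‖fderiv ℝ f y - fderiv ℝ f x‖ ≤ B * ‖y - x‖ := fun y hy =>
    (convex_ball x₀ r).norm_image_sub_le_of_norm_fderiv_le (fun z _ => hd z)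
      (fun z hz => by
        rw [← norm_iteratedFDeriv_zero (𝕜 := ℝ) (f := fderiv ℝ (fderiv ℝ f)),
          norm_iteratedFDeriv_fderiv, norm_iteratedFDeriv_fderiv]
        exact hB z hz) hx hy
  have h2 := ((convex_ball x₀ r).inter (convex_closedBall x ‖w‖)).norm_image_sub_le_of_norm_fderiv_le'
    (f := f) (φ := fderiv ℝ f x) (C := B * ‖w‖) (x := x) (y := x + w)
    (fun z _ => hf.differentiable (by simp) z)
    (fun z hz => (h1 z hz.1).trans (by gcongr; simpa [dist_eq_norm] using hz.2))
    ⟨hx, by simp⟩ ⟨hw, by simp⟩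
  simpa using h2

lemma uniformCauchySeqOn_fderiv {F : Type*} [NormedAddCommGroup F] [NormedSpace ℝ F]
    {f : ℕ → E → F} {g : E → F} {x₀ : E} {r r' B : ℝ} (hr : r' < r)
    (hf : ∀ n, ContDiff ℝ (⊤ : ℕ∞) (f n))
    (hB : ∀ n, ∀ y ∈ ball x₀ r, ‖iteratedFDeriv ℝ 2 (f n) y‖ ≤ B)
    (hfg : TendstoUniformlyOn f g atTop (ball x₀ r)) :
    UniformCauchySeqOn (fun n => fderiv ℝ (f n)) atTop (ball x₀ r') := by
  rw [Metric.uniformCauchySeqOn_iff]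
  intro ε hε
  rcases (ball x₀ r').eq_empty_or_nonempty with he | ⟨z, hz⟩
  · exact ⟨0, fun m _ n _ x hx => by simp [he] at hx⟩
  have hB0 : 0 ≤ B := (norm_nonneg _).trans (hB 0 z (ball_subset_ball hr.le hz))
  obtain ⟨t, ht, htr, htB⟩ : ∃ t : ℝ, 0 < t ∧ t ≤ r - r' ∧ 8 * B * t ≤ ε := by
    refine ⟨min (r - r') (ε / (8 * (B + 1))), lt_min (by linarith) (by positivity),
      min_le_left _ _, ?_⟩
    calc 8 * B * _ ≤ 8 * (B + 1) * (ε / (8 * (B + 1))) := by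
          gcongr
          · linarith
          · exact min_le_right _ _
      _ = ε := by field_simp
  obtain ⟨N, hN⟩ := Metric.uniformCauchySeqOn_iff.1 hfg.uniformCauchySeqOn (ε * t / 8)
    (by positivity)
  refine ⟨N, fun m hm n hn x hx => ?_⟩
  rw [dist_eq_norm]
  refine lt_of_le_of_lt (b := ε / 2) ?_ (by linarith)
  refine ContinuousLinearMap.opNorm_le_of_unit_norm (by positivity) fun u hu => ?_
  have hw : ‖t • u‖ = t := by rw [norm_smul, hu, mul_one, Real.norm_of_nonneg ht.le]
  have hx1 : x ∈ ball x₀ r := ball_subset_ball hr.le hx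
  have hx2 : x + t • u ∈ ball x₀ r := by
    rw [mem_ball] at hx ⊢
    calc dist (x + t • u) x₀ ≤ dist (x + t • u) x + dist x x₀ := dist_triangle _ _ _
      _ < t + r' := by
        have : dist (x + t • u) x = t := by rw [dist_eq_norm, add_sub_cancel_left, hw]
        rw [this]; linarith
      _ ≤ r := by linarith
  have e1 := norm_image_sub_sub_fderiv_le (hf m) (hB m) hx1 hx2
  have e2 := norm_image_sub_sub_fderiv_le (hf n) (hB n) hx1 hx2
  have e3 := hN m hm n hn x hx1
  have e4 := hN m hm n hn _ hx2
  rw [dist_eq_norm] at e3 e4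
  rw [hw] at e1 e2
  have key : (fderiv ℝ (f m) x - fderiv ℝ (f n) x) (t • u) =
      (f m (x + t • u) - f n (x + t • u)) - (f m x - f n x) -
      (f m (x + t • u) - f m x - fderiv ℝ (f m) x (t • u)) +
      (f n (x + t • u) - f n x - fderiv ℝ (f n) x (t • u)) := by
    rw [sub_apply]; abel
  have h5 : t * ‖(fderiv ℝ (f m) x - fderiv ℝ (f n) x) u‖ ≤ t * (ε / 2) := by
    calc _ = ‖(fderiv ℝ (f m) x - fderiv ℝ (f n) x) (t • u)‖ := by
          rw [map_smul, norm_smul, Real.norm_of_nonneg ht.le]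
      _ ≤ ε * t / 8 + ε * t / 8 + B * t * t + B * t * t := by
          rw [key]
          refine (norm_add_le _ _).trans (add_le_add ((norm_sub_le _ _).trans (add_le_add
            ((norm_sub_le _ _).trans (add_le_add e4.le e3.le)) e1)) e2)
      _ ≤ _ := by nlinarith [mul_le_mul_of_nonneg_right htB ht.le]
  exact le_of_mul_le_mul_left h5 ht

/-- A uniform limit of smooth functions with uniformly bounded derivatives is smooth, and the
bounds persist. -/
lemma contDiffOn_and_bound_of_tendstoUniformlyOn (N : ℕ) {F : Type u} [NormedAddCommGroup F]
    [NormedSpace ℝ F] [CompleteSpace F] {f : ℕ → E → F} {g : E → F} {x₀ : E} {r r' : ℝ} {B : ℕ → ℝ}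
    (hr : r' < r) (hf : ∀ n, ContDiff ℝ (⊤ : ℕ∞) (f n))
    (hB : ∀ n k, ∀ y ∈ ball x₀ r, ‖iteratedFDeriv ℝ k (f n) y‖ ≤ B k)
    (hfg : TendstoUniformlyOn f g atTop (ball x₀ r)) :
    ContDiffOn ℝ N g (ball x₀ r') ∧
      ∀ k ≤ N, ∀ y ∈ ball x₀ r', ‖iteratedFDeriv ℝ k g y‖ ≤ B k := by
  have hpt : ∀ y ∈ ball x₀ r, Tendsto (fun n => f n y) atTop (𝓝 (g y)) := fun y hy =>
    hfg.tendsto_at hy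
  have hzero : ∀ y ∈ ball x₀ r', ‖iteratedFDeriv ℝ 0 g y‖ ≤ B 0 := fun y hy => by
    rw [norm_iteratedFDeriv_zero]
    refine le_of_tendsto (hpt y (ball_subset_ball hr.le hy)).norm (Eventually.of_forall fun n => ?_)
    rw [← norm_iteratedFDeriv_zero (𝕜 := ℝ)]
    exact hB n 0 y (ball_subset_ball hr.le hy)
  induction N generalizing F r r' B with
  | zero =>
    refine ⟨?_, fun k hk => by rw [Nat.le_zero.1 hk]; exact hzero⟩
    rw [Nat.cast_zero, contDiffOn_zero]
    exact (hfg.continuousOn (Frequently.of_forall fun n => (hf n).continuous.continuousOn)).mono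
      (ball_subset_ball hr.le)
  | succ N ih =>
    set s := (r + r') / 2 with hs
    have hs1 : s < r := by rw [hs]; linarith
    have hs2 : r' < s := by rw [hs]; linarith
    have hc := uniformCauchySeqOn_fderiv hs1 hf (fun n => hB n 2) hfg
    have hlim : ∀ y ∈ ball x₀ s, ∃ L, Tendsto (fun n => fderiv ℝ (f n) y) atTop (𝓝 L) :=
      fun y hy => cauchySeq_tendsto_of_complete (hc.cauchySeq hy)
    choose! g' hg' using hlim
    have hu := hc.tendstoUniformlyOn_of_tendsto hg'
    have hder : ∀ y ∈ ball x₀ s, HasFDerivAt g (g' y) y := fun y hy =>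
      hasFDerivAt_of_tendstoUniformlyOn isOpen_ball hu
        (fun n z _ => ((hf n).differentiable (by simp) z).hasFDerivAt)
        (fun z hz => hpt z (ball_subset_ball hs1.le hz)) hy
    have hu' : TendstoUniformlyOn (fun n => fderiv ℝ (f n)) (fderiv ℝ g) atTop (ball x₀ s) :=
      hu.congr_right fun y hy => (hder y hy).fderiv.symm
    have hB' : ∀ n k, ∀ y ∈ ball x₀ s, ‖iteratedFDeriv ℝ k (fderiv ℝ (f n)) y‖ ≤ B (k + 1) :=
      fun n k y hy => by
        rw [norm_iteratedFDeriv_fderiv]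
        exact hB n (k + 1) y (ball_subset_ball hs1.le hy)
    obtain ⟨h1, h2⟩ := ih (B := fun k => B (k + 1)) hs2
      (fun n => (hf n).fderiv_right (by simp)) hB' hu'
      (fun y hy => hu'.tendsto_at hy)
      (fun y hy => by
        rw [norm_iteratedFDeriv_zero]
        refine le_of_tendsto (hu'.tendsto_at (ball_subset_ball hs2.le hy)).norm
          (Eventually.of_forall fun n => ?_)
        rw [← norm_iteratedFDeriv_zero (𝕜 := ℝ)]
        exact hB' n 0 y (ball_subset_ball hs2.le hy))
    refine ⟨?_, fun k hk => ?_⟩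
    · rw [Nat.cast_succ, contDiffOn_succ_iff_fderiv_of_isOpen isOpen_ball]
      exact ⟨fun y hy =>
        (hder y (ball_subset_ball hs2.le hy)).differentiableAt.differentiableWithinAt,
        fun h => absurd h (by simp), h1⟩
    · cases k with
      | zero => exact hzero
      | succ k =>
        intro y hy
        rw [← norm_iteratedFDeriv_fderiv]
        exact h2 k (Nat.le_of_succ_le_succ hk) y hy

end SmoothLimit

section Mollify

open MeasureTheory Convolution

variable {E : Type} [NormedAddCommGroup E] [InnerProductSpace ℝ E] [FiniteDimensional ℝ E]
  [MeasurableSpace E] [BorelSpace E]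

lemma norm_altSum_convolution_le (φ : ContDiffBump (0 : E)) {g : E → ℂ}
    (hg : LocallyIntegrable g volume) {x v : E} {k : ℕ} {t D : ℝ}
    (h : ∀ y ∈ ball (0 : E) φ.rOut, ‖altSum k (fun i => g (x - y + ((i : ℝ) * t) • v))‖ ≤ D) :
    ‖altSum k (fun i => (φ.normed volume ⋆[ContinuousLinearMap.lsmul ℝ ℝ, volume] g)
      (x + ((i : ℝ) * t) • v))‖ ≤ D := by
  have hex : ConvolutionExists (φ.normed volume) g (ContinuousLinearMap.lsmul ℝ ℝ) volume :=
    φ.hasCompactSupport_normed.convolutionExists_left _ φ.continuous_normed hg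
  have heq : altSum k (fun i => (φ.normed volume ⋆[ContinuousLinearMap.lsmul ℝ ℝ, volume] g)
      (x + ((i : ℝ) * t) • v)) =
      ∫ y, φ.normed volume y • altSum k (fun i => g (x - y + ((i : ℝ) * t) • v)) := by
    simp only [altSum, convolution_def]
    simp_rw [← integral_const_mul]
    rw [← integral_finsetSum _ fun (i : ℕ) _ =>
      (hex (x + ((i : ℝ) * t) • v)).integrable.const_mul ((-1) ^ (k - i) * (k.choose i : ℂ))]
    refine integral_congr_ae (Eventually.of_forall fun y => ?_)
    simp only [ContinuousLinearMap.lsmul_apply, Finset.smul_sum]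
    refine Finset.sum_congr rfl fun i _ => ?_
    rw [mul_smul_comm, add_sub_right_comm]
  rw [heq]
  calc _ ≤ ∫ y, φ.normed volume y * D := by
        refine norm_integral_le_of_norm_le (φ.integrable_normed.mul_const D)
          (Eventually.of_forall fun y => ?_)
        rw [norm_smul, Real.norm_of_nonneg (φ.nonneg_normed y)]
        by_cases hy : y ∈ ball (0 : E) φ.rOut
        · exact mul_le_mul_of_nonneg_left (h y hy) (φ.nonneg_normed y)
        · have : φ.normed volume y = 0 := by
            rw [← Function.notMem_support, φ.support_normed_eq]; exact hy
          simp [this]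
    _ = D := by rw [integral_mul_const, φ.integral_normed, one_mul]

/-- A continuous function whose forward differences in all directions satisfy the estimates of
derivatives is smooth, with the corresponding bounds on its derivatives. -/
lemma contDiffOn_and_bound_of_altSum_le {f : E → ℂ} {x₀ : E} {r : ℝ} (hr : 0 < r)
    (hf : ContinuousOn f (closedBall x₀ (4 * r))) {D t₀ : ℕ → ℝ} (ht₀ : ∀ k, 0 < t₀ k)
    (h : ∀ x ∈ ball x₀ (2 * r), ∀ v : E, ‖v‖ ≤ 1 → ∀ k, ∀ t : ℝ, 0 < t → t < t₀ k →
      ‖altSum k (fun i => f (x + ((i : ℝ) * t) • v))‖ ≤ D k * t ^ k) :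
    ContDiffOn ℝ (⊤ : ℕ∞) f (ball x₀ (r / 2)) ∧
      ∀ k, ∀ y ∈ ball x₀ (r / 2), ‖iteratedFDeriv ℝ k f y‖ ≤ (2 * Real.exp 1) ^ k * D k := by
  set K := closedBall x₀ (4 * r) with hK
  have hKc : IsCompact K := isCompact_closedBall _ _
  set g : E → ℂ := K.indicator f with hg
  have hgf : ∀ x ∈ K, g x = f x := fun x hx => indicator_of_mem hx f
  have hgi : Integrable g volume :=
    (integrable_indicator_iff hKc.measurableSet).2 (hf.integrableOn_compact hKc)
  have hgl := hgi.locallyIntegrable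
  set φ : ℕ → ContDiffBump (0 : E) := fun n =>
    ⟨r / (2 * (n + 2)), r / (n + 2), by positivity, by
      rw [div_lt_div_iff_of_pos_left hr (by positivity) (by positivity)]
      linarith [(Nat.cast_nonneg n : (0 : ℝ) ≤ n)]⟩ with hφ
  have hφr : ∀ n, (φ n).rOut = r / (n + 2) := fun n => rfl
  have hφr1 : ∀ n, (φ n).rOut ≤ r := fun n => by
    rw [hφr]
    exact div_le_self hr.le (by linarith [(Nat.cast_nonneg n : (0 : ℝ) ≤ n)])
  set F : ℕ → E → ℂ := fun n =>
    (φ n).normed volume ⋆[ContinuousLinearMap.lsmul ℝ ℝ, volume] g with hF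
  have hFs : ∀ n, ContDiff ℝ (⊤ : ℕ∞) (F n) := fun n =>
    (φ n).hasCompactSupport_normed.contDiff_convolution_left _ (φ n).contDiff_normed hgl
  have hFb : ∀ n k, ∀ y ∈ ball x₀ r,
      ‖iteratedFDeriv ℝ k (F n) y‖ ≤ (2 * Real.exp 1) ^ k * D k := by
    intro n k x hx
    refine norm_le_of_norm_apply_diagonal_le
      (fun v σ => iteratedFDeriv_comp_perm_of_contDiff (hFs n) k x v σ) fun v hv => ?_
    refine norm_iteratedFDeriv_diagonal_le_of_altSum (hFs n) (t₀ := min (t₀ k) (r / (k + 1)))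
      (lt_min (ht₀ k) (by positivity)) fun t ht htt => ?_
    refine norm_altSum_convolution_le (φ n) hgl fun y hy => ?_
    have hxy : x - y ∈ ball x₀ (2 * r) := by
      rw [mem_ball_iff_norm] at hx ⊢
      rw [mem_ball_zero_iff] at hy
      calc ‖x - y - x₀‖ = ‖(x - x₀) - y‖ := by congr 1; abel
        _ ≤ ‖x - x₀‖ + ‖y‖ := norm_sub_le _ _
        _ < r + r := add_lt_add_of_lt_of_le hx (hy.le.trans (hφr1 n))
        _ = 2 * r := by ring
    have h1 := h _ hxy v hv k t ht (htt.trans_le (min_le_left _ _))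
    have h2 : altSum k (fun i => g (x - y + ((i : ℝ) * t) • v)) =
        altSum k (fun i => f (x - y + ((i : ℝ) * t) • v)) := by
      refine Finset.sum_congr rfl fun i hi => ?_
      congr 1
      refine hgf _ ?_
      have hik : (i : ℝ) ≤ k + 1 := by
        exact_mod_cast (Finset.mem_range_succ_iff.1 hi).trans (Nat.le_succ k)
      have ht2 : (k + 1) * t ≤ r := by
        have := htt.le.trans (min_le_right _ _)
        rwa [le_div_iff₀ (by positivity), mul_comm] at this
      rw [hK, mem_closedBall_iff_norm]
      rw [mem_ball_iff_norm] at hxy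
      calc ‖x - y + ((i : ℝ) * t) • v - x₀‖ = ‖(x - y - x₀) + ((i : ℝ) * t) • v‖ := by
            congr 1; abel
        _ ≤ ‖x - y - x₀‖ + ‖((i : ℝ) * t) • v‖ := norm_add_le _ _
        _ ≤ 2 * r + (k + 1) * t * 1 := by
            rw [norm_smul, Real.norm_of_nonneg (by positivity)]
            gcongr
        _ ≤ 4 * r := by linarith
    rw [h2]
    exact h1
  have hFu : TendstoUniformlyOn F f atTop (ball x₀ r) := by
    rw [Metric.tendstoUniformlyOn_iff]
    intro ε hε
    have huc := hKc.uniformContinuousOn_of_continuous hf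
    obtain ⟨δ, hδ, hδε⟩ := Metric.uniformContinuousOn_iff.1 huc (ε / 2) (by positivity)
    obtain ⟨n₀, hn₀⟩ := exists_nat_gt (r / δ)
    filter_upwards [eventually_ge_atTop n₀] with n hn x hx
    have hxK : x ∈ K := ball_subset_closedBall (ball_subset_ball (by linarith) hx)
    have hsmall : (φ n).rOut ≤ δ := by
      rw [hφr, div_le_iff₀ (by positivity)]
      have h1 : r < n₀ * δ := by rwa [div_lt_iff₀ hδ] at hn₀
      have h2 : (n₀ : ℝ) ≤ n := by exact_mod_cast hn
      nlinarith
    have h1 := (φ n).dist_normed_convolution_le (μ := volume) (g := g) (x₀ := x) (ε := ε / 2)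
      hgi.aestronglyMeasurable (fun y hy => by
        have hyK : y ∈ K := by
          rw [hK, mem_closedBall]
          have := dist_triangle y x x₀
          rw [mem_ball] at hx hy
          linarith [hφr1 n]
        rw [hgf y hyK, hgf x hxK]
        exact (hδε y hyK x hxK ((mem_ball.1 hy).trans_le hsmall)).le)
    rw [hgf x hxK] at h1
    rw [dist_comm]
    exact h1.trans_lt (by linarith)
  have hlim := fun N => contDiffOn_and_bound_of_tendstoUniformlyOn N (half_lt_self hr) hFs hFb hFu
  exact ⟨contDiffOn_infty.2 fun N => (hlim N).1, fun k => (hlim k).2 k le_rfl⟩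

end Mollify

lemma admissibleSeq_lc {M : ℕ → ℝ} (hM : IsWeightSeq M) (hroot : RootsTendsto (lc M))
    (hGamma : ∃ C : ℝ, 1 ≤ C ∧
      ∀ t : ℝ, 0 < t → GammaUpper (lc M) (C * t) ≤ GammaLower (lc M) t)
    (hmg : mg M M < ⊤) : AdmissibleSeq (lc M) where
  pos := lc_pos hM
  root := hroot
  zero := lc_zero hM
  gamma := hGamma
  growth := by
    obtain ⟨ρ, hρ, h⟩ := exists_le_of_mg_lt_top hM hmg
    exact ⟨ρ, hρ, lc_add_le hM hρ h⟩

lemma continuousOn_of_pow {X : Type*} [TopologicalSpace X] {U : Set X} {f : X → ℂ} {j : ℕ}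
    (hj : 1 ≤ j) (h1 : ContinuousOn (fun x => f x ^ j) U)
    (h2 : ContinuousOn (fun x => f x ^ (j + 1)) U) : ContinuousOn f U := by
  intro x hx
  by_cases hfx : f x = 0
  · have h := ((h1 x hx).norm).rpow_const (p := (j : ℝ)⁻¹) (Or.inr (by positivity))
    have hroot : ∀ y, ‖f y ^ j‖ ^ ((j : ℝ)⁻¹) = ‖f y‖ := fun y => by
      rw [norm_pow, Real.pow_rpow_inv_natCast (norm_nonneg _) (by lia)]
    simp only [hroot] at h
    unfold ContinuousWithinAt at h ⊢
    simp only [hfx, norm_zero] at h ⊢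
    exact tendsto_zero_iff_norm_tendsto_zero.2 h
  · have h := (h2 x hx).div (h1 x hx) (pow_ne_zero j hfx)
    have hquot : ∀ y, f y = f y ^ (j + 1) / f y ^ j := fun y => by
      by_cases hy : f y = 0
      · simp [hy]
      · rw [pow_succ', mul_div_cancel_right₀ _ (pow_ne_zero j hy)]
    exact h.congr (fun y _ => hquot y) (hquot x)

lemma Roumieu.exists_iteratedFDeriv_le {E : Type*} [NormedAddCommGroup E] [NormedSpace ℝ E]
    {M : ℕ → ℝ} {U K : Set E} {g : E → ℂ} (hU : IsOpen U)
    (h : Roumieu {M} U g) (hKU : K ⊆ U) (hK : IsCompact K) :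
    ∃ C ρ : ℝ, 0 < ρ ∧ ∀ x ∈ K, ∀ k, ‖iteratedFDeriv ℝ k g x‖ ≤ C * ρ ^ k * M k := by
  obtain ⟨N, rfl, ρ, hρ, C, hC⟩ := h.2 K hKU hK
  refine ⟨C, ρ, hρ, fun x hx k => ?_⟩
  rw [← iteratedFDerivWithin_of_isOpen k hU (hKU hx)]
  exact hC x hx k

lemma exists_ball_iteratedFDeriv_le {E : Type} [NormedAddCommGroup E] [InnerProductSpace ℝ E]
    [FiniteDimensional ℝ E] [MeasurableSpace E] [BorelSpace E] {M : ℕ → ℝ}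
    (hM : ∀ k, 0 < M k) (hm : AdmissibleSeq (lc M))
    {U : Set E} (hU : IsOpen U) {j : ℕ} (hj : 1 ≤ j) {f : E → ℂ}
    (h1 : Roumieu {M} U (fun x => f x ^ j)) (h2 : Roumieu {M} U (fun x => f x ^ (j + 1)))
    {x₀ : E} (hx₀ : x₀ ∈ U) :
    ∃ δ : ℝ, 0 < δ ∧ ContDiffOn ℝ (⊤ : ℕ∞) f (ball x₀ δ) ∧ ∃ C ρ : ℝ, 0 ≤ C ∧ 0 < ρ ∧
      ∀ y ∈ ball x₀ δ, ∀ k, ‖iteratedFDeriv ℝ k f y‖ ≤ C * ρ ^ k * M k := by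
  obtain ⟨ε, hε, hεU⟩ := nhds_basis_closedBall.mem_iff.1 (hU.mem_nhds hx₀)
  obtain ⟨r, hr, rfl⟩ : ∃ r : ℝ, 0 < r ∧ 4 * r = ε := ⟨ε / 4, by positivity, by ring⟩
  obtain ⟨C₁, ρ₁, hρ₁, hb₁⟩ := h1.exists_iteratedFDeriv_le hU hεU (isCompact_closedBall _ _)
  obtain ⟨C₂, ρ₂, hρ₂, hb₂⟩ := h2.exists_iteratedFDeriv_le hU hεU (isCompact_closedBall _ _)
  obtain ⟨A, hA, hA₁, hA₂⟩ : ∃ A : ℝ, 1 ≤ A ∧ C₁ ≤ A ∧ C₂ ≤ A :=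
    ⟨max 1 (max C₁ C₂), by simp, by simp, by simp⟩
  obtain ⟨ρ, hρ, hρl₁, hρl₂⟩ : ∃ ρ : ℝ, 0 < ρ ∧ ρ₁ ≤ ρ ∧ ρ₂ ≤ ρ :=
    ⟨max ρ₁ ρ₂, by positivity, by simp, by simp⟩
  obtain ⟨C, ρ', τ₀, hC, hρ', hτ₀, hmain⟩ :=
    exists_norm_altSum_le hm hj hA hρ (by positivity : 0 < 2 * r)
  have hjet : ∀ {g : E → ℂ} {C' ρ'' : ℝ}, ContDiffOn ℝ (⊤ : ℕ∞) g U → C' ≤ A → 0 < ρ'' → ρ'' ≤ ρ →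
      (∀ x ∈ closedBall x₀ (4 * r), ∀ k, ‖iteratedFDeriv ℝ k g x‖ ≤ C' * ρ'' ^ k * M k) →
      ∀ x ∈ ball x₀ (2 * r), ∀ v : E, ‖v‖ ≤ 1 →
        JetBound (lc M) A ρ (2 * r) (fun s => g (x + s • v)) := by
    intro g C' ρ'' hg hCA hρ0 hρρ hb x hx v hv
    have hmem : ∀ s : ℝ, |s| < 2 * r → x + s • v ∈ closedBall x₀ (4 * r) := by
      intro s hs
      have hsv : ‖s • v‖ ≤ 2 * r := by
        rw [norm_smul, Real.norm_eq_abs]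
        nlinarith [abs_nonneg s, norm_nonneg v]
      have hx' : ‖x - x₀‖ < 2 * r := by rwa [mem_ball, dist_eq_norm] at hx
      rw [mem_closedBall, dist_eq_norm, add_sub_right_comm]
      linarith [norm_add_le (x - x₀) (s • v)]
    refine jetBound_of_iteratedFDeriv_le (by positivity) hv hM (by positivity) hρ
      (fun s hs => hg.contDiffAt (hU.mem_nhds (hεU (hmem s hs)))) fun s hs k => ?_
    refine (hb _ (hmem s hs) k).trans ?_
    have := (hM k).le
    gcongr
  have hf := (continuousOn_of_pow hj h1.1.continuousOn h2.1.continuousOn).mono hεU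
  obtain ⟨hsmooth, hbound⟩ := contDiffOn_and_bound_of_altSum_le hr hf
    (D := fun k => C * ρ' ^ k * (k.factorial * lc M k)) (t₀ := fun k => τ₀ / (k + 1))
    (fun k => by positivity) fun x hx v hv k t ht htk => by
      refine hmain (fun s => f (x + s • v)) (hjet h1.1 hA₁ hρ₁ hρl₁ hb₁ x hx v hv)
        (hjet h2.1 hA₂ hρ₂ hρl₂ hb₂ x hx v hv) k t ht ?_
      rw [lt_div_iff₀ (by positivity)] at htk
      linarith
  refine ⟨r / 2, by positivity, hsmooth, C, 2 * Real.exp 1 * ρ', hC.le, by positivity,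
    fun y hy k => (hbound k y hy).trans_eq ?_⟩
  have : (k.factorial : ℝ) * lc M k = M k := by
    unfold lc
    field_simp
  simp only [this, mul_pow]
  ring

/-- Joris' theorem for the Roumieu Denjoy–Carleman class of a single weight sequence. -/
theorem statement2 {d : ℕ} (M : ℕ → ℝ) (hM : IsWeightSeq M)
    (hroot : RootsTendsto (lc M))
    (hGamma : ∃ C : ℝ, 1 ≤ C ∧
      ∀ t : ℝ, 0 < t → GammaUpper (lc M) (C * t) ≤ GammaLower (lc M) t)
    (hmg : mg M M < ⊤)
    (U : Set (EuclideanSpace ℝ (Fin d))) (hU : IsOpen U)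
    (j : ℕ) (hj : 1 ≤ j) (f : EuclideanSpace ℝ (Fin d) → ℂ)
    (h1 : Roumieu {M} U (fun x => f x ^ j))
    (h2 : Roumieu {M} U (fun x => f x ^ (j + 1))) :
    Roumieu {M} U f := by
  have hloc := fun x hx => exists_ball_iteratedFDeriv_le hM.pos
    (admissibleSeq_lc hM hroot hGamma hmg) hU hj h1 h2 (x₀ := x) hx
  refine ⟨fun x hx => ?_, fun K hKU hK => ?_⟩
  · obtain ⟨δ, hδ, hf, -⟩ := hloc x hx
    exact (hf.contDiffAt (ball_mem_nhds x hδ)).contDiffWithinAt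
  obtain ⟨C, ρ, -, hρ, hb⟩ : ∃ C ρ : ℝ, 0 ≤ C ∧ 0 < ρ ∧
      ∀ y ∈ K, ∀ k, ‖iteratedFDeriv ℝ k f y‖ ≤ C * ρ ^ k * M k := by
    refine hK.induction_on (p := fun s => ∃ C ρ : ℝ, 0 ≤ C ∧ 0 < ρ ∧
      ∀ y ∈ s, ∀ k, ‖iteratedFDeriv ℝ k f y‖ ≤ C * ρ ^ k * M k)
      ⟨0, 1, le_rfl, one_pos, by simp⟩ ?_ ?_ fun x hx => ?_
    · rintro s t hst ⟨C, ρ, hC, hρ, hb⟩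
      exact ⟨C, ρ, hC, hρ, fun y hy => hb y (hst hy)⟩
    · rintro s t ⟨C, ρ, hC, hρ, hb⟩ ⟨C', ρ', hC', hρ', hb'⟩
      refine ⟨max C C', max ρ ρ', by positivity, by positivity, fun y hy k => ?_⟩
      have hMk := (hM.pos k).le
      rcases hy with hy | hy
      · refine (hb y hy k).trans ?_
        gcongr <;> exact le_max_left _ _
      · refine (hb' y hy k).trans ?_
        gcongr <;> exact le_max_right _ _
    · obtain ⟨δ, hδ, -, C, ρ, hC, hρ, hb⟩ := hloc x (hKU hx)
      exact ⟨ball x δ, mem_nhdsWithin_of_mem_nhds (ball_mem_nhds x hδ), C, ρ, hC, hρ, hb⟩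
  refine ⟨M, rfl, ρ, hρ, C, fun x hx k => ?_⟩
  rw [iteratedFDerivWithin_of_isOpen k hU (hKU hx)]
  exact hb x hx k

end JorisPaper
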